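/- arXiv:1605.04730 — 2 statements merged into one kernel-verified Lean document; each statement's English description precedes it below -/
import Mathlib

section
/- For every connected finite simple graph G with m edges, s(G) ≤ (3/16)(m + 1); that is, G contains a set X of at most (3/16)(m+1) vertices such that G − X has no K₄ minor. -/
open SimpleGraph

/-- `G` has a `K₄` minor (branch-set formulation: four nonempty, pairwise disjoint,
connected branch sets with an edge between every two of them). -/
def HasK4Minor {V : Type*} (G : SimpleGraph V) : Prop :=
  ∃ B : Fin 4 → Set V,
    (∀ i, (B i).Nonempty) ∧
    (∀ i, (G.induce (B i)).Connected) ∧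
    (∀ i j, i ≠ j → Disjoint (B i) (B j)) ∧
    (∀ i j, i ≠ j → ∃ u ∈ B i, ∃ v ∈ B j, G.Adj u v)

/-- `X` is a transversal of `G`: the graph `G − X` has no `K₄` minor. -/
def IsTransversal {V : Type*} (G : SimpleGraph V) (X : Finset V) : Prop :=
  ¬ HasK4Minor (G.induce ((↑X : Set V)ᶜ))

/-- `s(G)`: the minimum size of a transversal of `G`. -/
noncomputable def transNum {V : Type*} (G : SimpleGraph V) : ℕ :=
  sInf {n : ℕ | ∃ X : Finset V, X.card = n ∧ IsTransversal G X}

namespace K4T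
open Classical

/-- cut-based connectivity of a vertex set -/
def Con {V : Type*} (G : SimpleGraph V) (B : Set V) : Prop :=
  ∀ C : Set V, C ⊆ B → C.Nonempty → (∀ u ∈ C, ∀ v ∈ B, G.Adj u v → v ∈ C) → B ⊆ C

/-- `K₄` minors with cut-based connectivity -/
def K4 {V : Type*} (G : SimpleGraph V) : Prop :=
  ∃ B : Fin 4 → Set V,
    (∀ i, (B i).Nonempty) ∧ (∀ i, Con G (B i)) ∧
    (∀ i j, i ≠ j → Disjoint (B i) (B j)) ∧
    (∀ i j, i ≠ j → ∃ u ∈ B i, ∃ v ∈ B j, G.Adj u v)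

/-- keep only the edges inside `C` -/
def rs {V : Type*} (G : SimpleGraph V) (C : Set V) : SimpleGraph V where
  Adj a b := G.Adj a b ∧ a ∈ C ∧ b ∈ C
  symm := ⟨fun _ _ h => ⟨h.1.symm, h.2.2, h.2.1⟩⟩
  loopless := ⟨fun _ h => G.loopless.irrefl _ h.1⟩

/-- isolate a vertex -/
def iso {V : Type*} (G : SimpleGraph V) (v : V) : SimpleGraph V := rs G {v}ᶜ

/-- delete `z` and join `a` and `b` -/
def spr {V : Type*} (G : SimpleGraph V) (z a b : V) : SimpleGraph V where
  Adj u v := (G.Adj u v ∧ u ≠ z ∧ v ≠ z) ∨ (a ≠ b ∧ ((u = a ∧ v = b) ∨ (u = b ∧ v = a)))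
  symm := ⟨fun _ _ h => by
    rcases h with h | ⟨h, h2⟩
    · exact Or.inl ⟨h.1.symm, h.2.2, h.2.1⟩
    · exact Or.inr ⟨h, by tauto⟩⟩
  loopless := ⟨fun v h => by
    rcases h with h | ⟨h, h2⟩
    · exact G.loopless.irrefl _ h.1
    · rcases h2 with h2 | h2
      · exact h (h2.1.symm.trans h2.2)
      · exact h (h2.2.symm.trans h2.1)⟩

section
variable {V : Type*}

theorem rs_adj {G : SimpleGraph V} {C : Set V} {a b : V} :
    (rs G C).Adj a b ↔ G.Adj a b ∧ a ∈ C ∧ b ∈ C := Iff.rfl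

theorem iso_adj {G : SimpleGraph V} {v a b : V} :
    (iso G v).Adj a b ↔ G.Adj a b ∧ a ≠ v ∧ b ≠ v := Iff.rfl

theorem spr_adj {G : SimpleGraph V} {z a b u v : V} :
    (spr G z a b).Adj u v ↔ (G.Adj u v ∧ u ≠ z ∧ v ≠ z) ∨
      (a ≠ b ∧ ((u = a ∧ v = b) ∨ (u = b ∧ v = a))) := Iff.rfl

theorem Con.mono {G H : SimpleGraph V} (h : ∀ a b, G.Adj a b → H.Adj a b) {B : Set V}
    (hB : Con G B) : Con H B :=
  fun C hC hne hcl => hB C hC hne (fun u hu v hv huv => hcl u hu v hv (h _ _ huv))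

theorem K4.mono {G H : SimpleGraph V} (h : ∀ a b, G.Adj a b → H.Adj a b) (hG : K4 G) : K4 H := by
  obtain ⟨B, h1, h2, h3, h4⟩ := hG
  refine ⟨B, h1, fun i => (h2 i).mono h, h3, fun i j hij => ?_⟩
  obtain ⟨u, hu, v, hv, huv⟩ := h4 i j hij
  exact ⟨u, hu, v, hv, h _ _ huv⟩

/-- the frozen notion gives ours -/
theorem K4_of_induce {G : SimpleGraph V} {S : Set V} (h : HasK4Minor (G.induce S)) :
    K4 (rs G S) := by
  obtain ⟨B, h1, h2, h3, h4⟩ := h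
  refine ⟨fun i => Subtype.val '' B i, fun i => (h1 i).image _, fun i => ?_, fun i j hij => ?_,
    fun i j hij => ?_⟩
  · intro C hC hne hcl
    obtain ⟨c, hc⟩ := hne
    obtain ⟨c', hc', rfl⟩ := hC hc
    rintro _ ⟨d, hd, rfl⟩
    obtain ⟨w⟩ := (h2 i).preconnected ⟨c', hc'⟩ ⟨d, hd⟩
    have key : ∀ (a b : B i) (w : ((G.induce S).induce (B i)).Walk a b),
        (a.1.1 ∈ C) → b.1.1 ∈ C := by
      intro a b w
      induction w with
      | nil => exact id
      | @cons u v w' hadj _ ih =>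
        intro hu
        apply ih
        exact hcl _ hu _ ⟨v.1, v.2, rfl⟩ ⟨hadj, u.1.2, v.1.2⟩
    exact key _ _ w hc
  · exact (Set.disjoint_image_iff Subtype.val_injective).2 (h3 i j hij)
  · obtain ⟨u, hu, v, hv, huv⟩ := h4 i j hij
    exact ⟨u.1, ⟨u, hu, rfl⟩, v.1, ⟨v, hv, rfl⟩, huv, u.2, v.2⟩

/-- suppressing a vertex of degree at most two -/
theorem K4.spr {G : SimpleGraph V} {z a b : V} (hN : ∀ u, G.Adj z u → u = a ∨ u = b)
    (hG : K4 G) : K4 (spr G z a b) := by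
  obtain ⟨B, h1, h2, h3, h4⟩ := hG
  have hdis : ∀ i j, i ≠ j → ∀ x, x ∈ B i → x ∈ B j → False := fun i j hij x hx hy =>
    Set.disjoint_left.1 (h3 i j hij) hx hy
  -- a branch set containing z has a neighbour of z
  have hnb : ∀ i, z ∈ B i → ∃ u ∈ B i, G.Adj z u := by
    intro i hz
    by_contra hcon
    push Not at hcon
    have hsub : B i ⊆ {z} := h2 i {z} (by simpa using hz) ⟨z, rfl⟩ (by
      rintro u rfl v hv huv
      exact absurd huv (hcon v hv))
    have hf : ∀ j, j ≠ i → ∃ v ∈ B j, v = a ∨ v = b := by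
      intro j hj
      obtain ⟨u, hu, v, hv, huv⟩ := h4 i j hj.symm
      have : u = z := hsub hu
      subst this
      exact ⟨v, hv, hN v huv⟩
    have h3' : ∀ i : Fin 4, ∃ j k l : Fin 4, j ≠ i ∧ k ≠ i ∧ l ≠ i ∧ j ≠ k ∧ j ≠ l ∧ k ≠ l := by
      decide
    obtain ⟨j, k, l, hj, hk, hl, hjk, hjl, hkl⟩ := h3' i
    obtain ⟨x, hx, hx'⟩ := hf j hj
    obtain ⟨y, hy, hy'⟩ := hf k hk
    obtain ⟨w, hw, hw'⟩ := hf l hl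
    have e1 : x ≠ y := fun e => hdis j k hjk x hx (e ▸ hy)
    have e2 : x ≠ w := fun e => hdis j l hjl x hx (e ▸ hw)
    have e3 : y ≠ w := fun e => hdis k l hkl y hy (e ▸ hw)
    rcases hx' with rfl | rfl <;> rcases hy' with rfl | rfl <;> rcases hw' with rfl | rfl <;>
      simp_all
  refine ⟨fun i => B i \ {z}, fun i => ?_, fun i => ?_, fun i j hij => ?_, fun i j hij => ?_⟩
  · by_cases hz : z ∈ B i
    · obtain ⟨u, hu, huz⟩ := hnb i hz
      exact ⟨u, hu, huz.ne'⟩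
    · obtain ⟨u, hu⟩ := h1 i
      exact ⟨u, hu, fun e => hz (e ▸ hu)⟩
  · intro C hC hne hcl
    have hCz : z ∉ C := fun h => (hC h).2 rfl
    have hstep : ∀ u ∈ C, ∀ v ∈ B i, v ≠ z → G.Adj u v → v ∈ C := fun u hu v hv hvz huv =>
      hcl u hu v ⟨hv, hvz⟩ (Or.inl ⟨huv, fun e => hCz (e ▸ hu), hvz⟩)
    by_cases hex : ∃ c ∈ C, G.Adj z c
    · obtain ⟨c, hc, hzc⟩ := hex
      have hall : ∀ u ∈ B i, G.Adj z u → u ∈ C := by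
        intro u hu hzu
        by_cases huc : u = c
        · exact huc ▸ hc
        · refine hcl c hc u ⟨hu, hzu.ne'⟩ (Or.inr ?_)
          rcases hN u hzu with rfl | rfl <;> rcases hN c hzc with rfl | rfl <;> simp_all
          exact fun e => huc e.symm
      have : B i ⊆ insert z C := by
        by_cases hz : z ∈ B i
        · apply h2 i
          · rintro u (rfl | hu)
            · exact hz
            · exact (hC hu).1
          · exact ⟨z, Or.inl rfl⟩
          · rintro u (rfl | hu) v hv huv
            · exact Or.inr (hall v hv huv)
            · by_cases hvz : v = z
              · exact Or.inl hvz
              · exact Or.inr (hstep u hu v hv hvz huv)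
        · intro u hu
          refine Or.inr ?_
          refine h2 i C (fun x hx => (hC hx).1) hne ?_ hu
          intro u hu v hv huv
          exact hstep u hu v hv (fun e => hz (e ▸ hv)) huv
      intro u hu
      rcases this hu.1 with h | h
      · exact absurd h hu.2
      · exact h
    · push Not at hex
      intro u hu
      refine h2 i C (fun x hx => (hC hx).1) hne ?_ hu.1
      intro x hx v hv hxv
      by_cases hvz : v = z
      · rw [hvz] at hxv
        exact absurd hxv.symm (hex x hx)
      · exact hstep x hx v hv hvz hxv
  · exact (h3 i j hij).mono Set.sdiff_subset Set.sdiff_subset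
  · have main : ∀ i j, i ≠ j → ∀ w ∈ B j, G.Adj z w → z ∈ B i →
        ∃ u ∈ B i \ {z}, ∃ v ∈ B j \ {z}, (K4T.spr G z a b).Adj u v := by
      intro i j hij w hw hzw hz
      obtain ⟨u, hu, hzu⟩ := hnb i hz
      have huw : u ≠ w := fun e => hdis i j hij u hu (e ▸ hw)
      refine ⟨u, ⟨hu, hzu.ne'⟩, w, ⟨hw, hzw.ne'⟩, Or.inr ?_⟩
      rcases hN u hzu with rfl | rfl <;> rcases hN w hzw with rfl | rfl <;> simp_all
      exact fun e => huw e.symm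
    obtain ⟨u, hu, v, hv, huv⟩ := h4 i j hij
    by_cases huz : u = z
    · subst huz
      exact main i j hij v hv huv hu
    · by_cases hvz : v = z
      · subst hvz
        obtain ⟨p, hp, q, hq, hpq⟩ := main j i hij.symm u hu huv.symm hv
        exact ⟨q, hq, p, hp, hpq.symm⟩
      · exact ⟨u, ⟨hu, huz⟩, v, ⟨hv, hvz⟩, Or.inl ⟨huv, huz, hvz⟩⟩

/-- one-sums, one-sided version -/
theorem K4.side {G : SimpleGraph V} {S : Set V} {p : V}
    (hcl : ∀ u ∈ S, u ≠ p → ∀ v, G.Adj u v → v ∈ S)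
    {B : Fin 4 → Set V}
    (h1 : ∀ i, (B i).Nonempty) (h2 : ∀ i, Con G (B i))
    (h3 : ∀ i j, i ≠ j → Disjoint (B i) (B j))
    (h4 : ∀ i j, i ≠ j → ∃ u ∈ B i, ∃ v ∈ B j, G.Adj u v)
    (hex : ∃ i, p ∉ B i ∧ ∃ u ∈ B i, u ∈ S) : K4 (rs G S) := by
  have hdis : ∀ i j, i ≠ j → ∀ x, x ∈ B i → x ∈ B j → False := fun i j hij x hx hy =>
    Set.disjoint_left.1 (h3 i j hij) hx hy
  -- a branch set without p which meets S lies in S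
  have hin : ∀ i, p ∉ B i → (∃ u ∈ B i, u ∈ S) → B i ⊆ S := by
    rintro i hp ⟨u, hu, huS⟩
    have := h2 i (B i ∩ S) Set.inter_subset_left ⟨u, hu, huS⟩ (by
      rintro x ⟨hx, hxS⟩ v hv hxv
      exact ⟨hv, hcl x hxS (fun e => hp (e ▸ hx)) v hxv⟩)
    exact fun x hx => (this hx).2
  obtain ⟨i0, hp0, hu0⟩ := hex
  have h0 := hin i0 hp0 hu0
  have hmeet : ∀ i, ∃ u ∈ B i, u ∈ S := by
    intro i
    by_cases hi : i = i0
    · exact hi ▸ hu0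
    · obtain ⟨u, hu, v, hv, huv⟩ := h4 i0 i (Ne.symm hi)
      exact ⟨v, hv, hcl u (h0 hu) (fun e => hp0 (e ▸ hu)) v huv⟩
  have hall : ∀ i, p ∉ B i → B i ⊆ S := fun i hi => hin i hi (hmeet i)
  refine ⟨fun i => B i ∩ S, fun i => ?_, fun i => ?_, fun i j hij => ?_, fun i j hij => ?_⟩
  · obtain ⟨u, hu, huS⟩ := hmeet i
    exact ⟨u, hu, huS⟩
  · intro C hC hne hc
    by_cases hp : p ∈ C
    · have : B i ⊆ C ∪ (B i \ S) := by
        apply h2 i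
        · rintro u (hu | hu)
          · exact (hC hu).1
          · exact hu.1
        · exact ⟨p, Or.inl hp⟩
        · rintro u (hu | hu) v hv huv
          · by_cases hvS : v ∈ S
            · exact Or.inl (hc u hu v ⟨hv, hvS⟩ ⟨huv, (hC hu).2, hvS⟩)
            · exact Or.inr ⟨hv, hvS⟩
          · by_cases hvS : v ∈ S
            · by_cases hvp : v = p
              · exact Or.inl (hvp ▸ hp)
              · exact absurd (hcl v hvS hvp u huv.symm) hu.2
            · exact Or.inr ⟨hv, hvS⟩
      intro u hu
      rcases this hu.1 with h | h
      · exact h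
      · exact absurd hu.2 h.2
    · intro u hu
      refine h2 i C (fun x hx => (hC hx).1) hne ?_ hu.1
      intro x hx v hv hxv
      have hvS := hcl x (hC hx).2 (fun e => hp (e ▸ hx)) v hxv
      exact hc x hx v ⟨hv, hvS⟩ ⟨hxv, (hC hx).2, hvS⟩
  · exact (h3 i j hij).mono Set.inter_subset_left Set.inter_subset_left
  · obtain ⟨u, hu, v, hv, huv⟩ := h4 i j hij
    have : u ∈ S ∧ v ∈ S := by
      by_cases hpi : p ∈ B i
      · have hpj : p ∉ B j := fun h => hdis i j hij p hpi h
        have hvS := hall j hpj hv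
        exact ⟨hcl v hvS (fun e => hpj (e ▸ hv)) u huv.symm, hvS⟩
      · have huS := hall i hpi hu
        exact ⟨huS, hcl u huS (fun e => hpi (e ▸ hu)) v huv⟩
    exact ⟨u, ⟨hu, this.1⟩, v, ⟨hv, this.2⟩, huv, this.1, this.2⟩

/-- one-sums -/
theorem K4.split {G : SimpleGraph V} {C : Set V} {p : V} (hpC : p ∉ C)
    (hcl : ∀ u ∈ C, ∀ v, G.Adj u v → v ∈ C ∨ v = p) (hG : K4 G) :
    K4 (rs G (insert p C)) ∨ K4 (rs G Cᶜ) := by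
  obtain ⟨B, h1, h2, h3, h4⟩ := hG
  have hex : ∃ i, p ∉ B i := by
    by_contra hcon
    push Not at hcon
    exact Set.disjoint_left.1 (h3 0 1 (by decide)) (hcon 0) (hcon 1)
  obtain ⟨i, hi⟩ := hex
  obtain ⟨u, hu⟩ := h1 i
  have hup : u ≠ p := fun e => hi (e ▸ hu)
  by_cases huC : u ∈ C
  · left
    refine K4.side (p := p) ?_ h1 h2 h3 h4 ⟨i, hi, u, hu, Or.inr huC⟩
    rintro x (rfl | hx) hxp v hxv
    · exact absurd rfl hxp
    · rcases hcl x hx v hxv with h | h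
      · exact Or.inr h
      · exact Or.inl h
  · right
    refine K4.side (p := p) ?_ h1 h2 h3 h4 ⟨i, hi, u, hu, huC⟩
    intro x hx hxp v hxv hv
    rcases hcl v hv x hxv.symm with h | h
    · exact hx h
    · exact hxp h

/-- `G` has a transversal with at most `k` vertices -/
def tr (G : SimpleGraph V) (k : ℕ) : Prop :=
  ∃ X : Finset V, X.card ≤ k ∧ ¬ K4 (rs G (↑X : Set V)ᶜ)

theorem tr.mono {G : SimpleGraph V} {k l : ℕ} (h : tr G k) (hkl : k ≤ l) : tr G l := by
  obtain ⟨X, hX, h⟩ := h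
  exact ⟨X, hX.trans hkl, h⟩

theorem tr.transNum_le {G : SimpleGraph V} {k : ℕ} (h : tr G k) : transNum G ≤ k := by
  obtain ⟨X, hX, h⟩ := h
  refine le_trans (Nat.sInf_le ⟨X, rfl, ?_⟩) hX
  exact fun hm => h (K4_of_induce hm)

theorem tr.of_iso {G : SimpleGraph V} {v : V} {k : ℕ} (h : tr (iso G v) k) : tr G (k + 1) := by
  obtain ⟨X, hX, h⟩ := h
  refine ⟨insert v X, (Finset.card_insert_le _ _).trans (by omega), fun hm => h (hm.mono ?_)⟩
  rintro a b ⟨hab, ha, hb⟩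
  simp at ha hb
  exact ⟨⟨hab, ha.1, hb.1⟩, ha.2, hb.2⟩

theorem tr.of_split {G : SimpleGraph V} {C : Set V} {p : V} (hpC : p ∉ C)
    (hcl : ∀ u ∈ C, ∀ v, G.Adj u v → v ∈ C ∨ v = p) {k l : ℕ}
    (h1 : tr (rs G (insert p C)) k) (h2 : tr (rs G Cᶜ) l) : tr G (k + l) := by
  obtain ⟨X, hX, h1⟩ := h1
  obtain ⟨Y, hY, h2⟩ := h2
  refine ⟨X ∪ Y, (Finset.card_union_le _ _).trans (by omega), fun hm => ?_⟩
  rcases K4.split (G := rs G (↑(X ∪ Y) : Set V)ᶜ) (C := C) (p := p) hpC (fun u hu v huv => hcl u hu v huv.1) hm with h | h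
  · refine h1 (h.mono ?_)
    rintro a b ⟨⟨hab, ha, hb⟩, ha', hb'⟩
    simp at ha hb
    exact ⟨⟨hab, ha', hb'⟩, ha.1, hb.1⟩
  · refine h2 (h.mono ?_)
    rintro a b ⟨⟨hab, ha, hb⟩, ha', hb'⟩
    simp at ha hb
    exact ⟨⟨hab, ha', hb'⟩, ha.2, hb.2⟩

theorem tr.of_spr {G : SimpleGraph V} {z a b : V} (hN : ∀ u, G.Adj z u → u = a ∨ u = b)
    {k : ℕ} (h : tr (K4T.spr G z a b) k) : tr G k := by
  obtain ⟨X, hX, h⟩ := h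
  refine ⟨X, hX, fun hm => h ?_⟩
  by_cases ha : a ∈ X
  · refine (hm.spr (z := z) (a := b) (b := b) ?_).mono ?_
    · rintro u ⟨hzu, _, hu⟩
      rcases hN u hzu with rfl | rfl
      · exact absurd ha hu
      · exact Or.inl rfl
    · rintro u v (⟨⟨huv, hu, hv⟩, hu', hv'⟩ | ⟨h, _⟩)
      · exact ⟨Or.inl ⟨huv, hu', hv'⟩, hu, hv⟩
      · exact absurd rfl h
  by_cases hb : b ∈ X
  · refine (hm.spr (z := z) (a := a) (b := a) ?_).mono ?_
    · rintro u ⟨hzu, _, hu⟩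
      rcases hN u hzu with rfl | rfl
      · exact Or.inl rfl
      · exact absurd hb hu
    · rintro u v (⟨⟨huv, hu, hv⟩, hu', hv'⟩ | ⟨h, _⟩)
      · exact ⟨Or.inl ⟨huv, hu', hv'⟩, hu, hv⟩
      · exact absurd rfl h
  · refine (hm.spr (z := z) (a := a) (b := b) ?_).mono ?_
    · rintro u ⟨hzu, _, hu⟩
      exact hN u hzu
    · rintro u v (⟨⟨huv, hu, hv⟩, hu', hv'⟩ | ⟨h, h'⟩)
      · exact ⟨Or.inl ⟨huv, hu', hv'⟩, hu, hv⟩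
      · refine ⟨Or.inr ⟨h, h'⟩, ?_⟩
        rcases h' with ⟨rfl, rfl⟩ | ⟨rfl, rfl⟩
        · exact ⟨ha, hb⟩
        · exact ⟨hb, ha⟩

/-- deleting a vertex of degree at most two whose neighbours are adjacent (or equal) -/
theorem tr.of_simp {G : SimpleGraph V} {z a b : V} (hN : ∀ u, G.Adj z u → u = a ∨ u = b)
    (hz : G.Adj z a ∧ G.Adj z b)
    (hab : a = b ∨ G.Adj a b) {k : ℕ} (h : tr (iso G z) k) : tr G k := by
  apply tr.of_spr hN
  convert h using 1
  ext u v
  rw [spr_adj, iso_adj]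
  constructor
  · rintro (h | ⟨h, h'⟩)
    · exact h
    · rcases hab with h2 | h2
      · exact absurd h2 h
      · rcases h' with ⟨rfl, rfl⟩ | ⟨rfl, rfl⟩
        · exact ⟨h2, hz.1.ne', hz.2.ne'⟩
        · exact ⟨h2.symm, hz.2.ne', hz.1.ne'⟩
  · exact Or.inl

theorem tr_bot {G : SimpleGraph V} (h : ∀ a b, ¬ G.Adj a b) : tr G 0 := by
  refine ⟨∅, le_rfl, ?_⟩
  rintro ⟨B, _, _, _, h4⟩
  obtain ⟨u, _, v, _, huv⟩ := h4 0 1 (by decide)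
  exact h u v huv.1

end


section
variable {V : Type*} [Fintype V]

/-- neighbours as a finset -/
noncomputable def nb (G : SimpleGraph V) (v : V) : Finset V := Finset.univ.filter (fun u => G.Adj v u)

/-- degree -/
noncomputable def dg (G : SimpleGraph V) (v : V) : ℕ := (nb G v).card

/-- twice the number of edges -/
noncomputable def E (G : SimpleGraph V) : ℕ := ∑ v, dg G v

/-- weights -/
def w : ℕ → ℕ
  | 0 => 0
  | 1 => 0
  | 2 => 0
  | 3 => 8
  | 4 => 12
  | (n + 5) => 3 * (n + 5)

/-- weight differences -/
def dl (d : ℕ) : ℕ := w d - w (d - 1)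

/-- potential -/
noncomputable def Ph (G : SimpleGraph V) : ℕ := ∑ v, w (dg G v)

/-- potential drop when deleting a vertex -/
noncomputable def drop (G : SimpleGraph V) (v : V) : ℕ := w (dg G v) + ∑ u ∈ nb G v, dl (dg G u)

theorem w_mono (d : ℕ) : w d ≤ w (d + 1) := by
  match d with
  | 0 => decide
  | 1 => decide
  | 2 => decide
  | 3 => decide
  | 4 => decide
  | (n + 5) => simp only [w]; omega

theorem w_dl (d : ℕ) : w (d + 1) = w d + dl (d + 1) := by
  have := w_mono d
  simp only [dl, Nat.add_sub_cancel]
  omega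

theorem w_le (d : ℕ) : w d ≤ 3 * d := by
  match d with
  | 0 => decide
  | 1 => decide
  | 2 => decide
  | 3 => decide
  | 4 => decide
  | (n + 5) => simp only [w]; omega

@[simp] theorem w0 : w 0 = 0 := rfl
@[simp] theorem w1 : w 1 = 0 := rfl
@[simp] theorem w2 : w 2 = 0 := rfl
@[simp] theorem w3 : w 3 = 8 := rfl
@[simp] theorem w4 : w 4 = 12 := rfl
@[simp] theorem w5 : w 5 = 15 := rfl
@[simp] theorem dl1 : dl 1 = 0 := rfl
@[simp] theorem dl2 : dl 2 = 0 := rfl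
@[simp] theorem dl3 : dl 3 = 8 := rfl
@[simp] theorem dl4 : dl 4 = 4 := rfl
@[simp] theorem dl5 : dl 5 = 3 := rfl

variable {G H : SimpleGraph V} {u v a b c z : V}

@[simp] theorem mem_nb : u ∈ nb G v ↔ G.Adj v u := by simp [nb]

theorem dg_pos : 0 < dg G v ↔ ∃ u, G.Adj v u := by
  rw [dg, Finset.card_pos]
  exact ⟨fun ⟨u, hu⟩ => ⟨u, mem_nb.1 hu⟩, fun ⟨u, hu⟩ => ⟨u, mem_nb.2 hu⟩⟩

theorem dg_pos' (h : G.Adj v u) : 0 < dg G v := dg_pos.2 ⟨u, h⟩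

theorem dg_congr (h : ∀ u, G.Adj v u ↔ H.Adj v u) : dg G v = dg H v := by
  have : nb G v = nb H v := by ext u; simp [h]
  rw [dg, dg, this]

theorem dg_zero (h : ∀ u, ¬ G.Adj v u) : dg G v = 0 := by
  by_contra hc
  obtain ⟨u, hu⟩ := dg_pos.1 (Nat.pos_of_ne_zero hc)
  exact h u hu

theorem not_adj_of_dg (h : dg G v = 0) : ¬ G.Adj v u := fun hu => by
  have := dg_pos' hu; omega

theorem dg_mono (h : ∀ u, G.Adj v u → H.Adj v u) : dg G v ≤ dg H v :=
  Finset.card_le_card (fun u hu => mem_nb.2 (h u (mem_nb.1 hu)))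

theorem dg_iso_self : dg (iso G v) v = 0 := dg_zero (fun _ h => h.2.1 rfl)

theorem nb_iso (h : u ≠ v) : nb (iso G v) u = (nb G u).erase v := by
  ext x
  simp only [mem_nb, iso_adj, Finset.mem_erase]
  tauto

theorem dg_iso_adj (h : G.Adj v u) : dg (iso G v) u + 1 = dg G u := by
  rw [dg, nb_iso h.ne', Finset.card_erase_add_one (mem_nb.2 h.symm), dg]

theorem dg_iso_adj' {n : ℕ} (h : G.Adj v u) (hn : dg G u = n + 1) : dg (iso G v) u = n := by
  have := dg_iso_adj h; omega

theorem dg_iso_nadj (hu : u ≠ v) (h : ¬ G.Adj v u) : dg (iso G v) u = dg G u := by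
  rw [dg, nb_iso hu, Finset.erase_eq_of_notMem (fun hx => h (mem_nb.1 hx).symm), dg]

theorem dg_iso_le : dg (iso G v) u ≤ dg G u := dg_mono (fun _ h => h.1)

theorem Ph_iso (v : V) : Ph G = Ph (iso G v) + drop G v := by
  have key : ∀ u, w (dg G u) = w (dg (iso G v) u) + ((if u = v then w (dg G v) else 0)
      + (if G.Adj v u then dl (dg G u) else 0)) := by
    intro u
    by_cases hu : u = v
    · subst hu
      simp [dg_iso_self]
    · by_cases ha : G.Adj v u
      · rw [← dg_iso_adj ha, w_dl]
        simp [hu, ha]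
      · rw [dg_iso_nadj hu ha]
        simp [hu, ha]
  rw [Ph, Finset.sum_congr rfl (fun u _ => key u), Finset.sum_add_distrib, Finset.sum_add_distrib]
  simp only [Ph, drop, nb, Finset.sum_filter]
  simp

theorem E_iso (v : V) : E G = E (iso G v) + 2 * dg G v := by
  have key : ∀ u, dg G u = dg (iso G v) u + ((if u = v then dg G v else 0)
      + (if G.Adj v u then 1 else 0)) := by
    intro u
    by_cases hu : u = v
    · subst hu
      simp [dg_iso_self]
    · by_cases ha : G.Adj v u
      · rw [← dg_iso_adj ha]
        simp [hu, ha]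
      · rw [dg_iso_nadj hu ha]
        simp [hu, ha]
  rw [E, Finset.sum_congr rfl (fun u _ => key u), Finset.sum_add_distrib, Finset.sum_add_distrib]
  have : dg G v = ∑ u, (if G.Adj v u then 1 else 0) := by
    rw [dg, nb, Finset.card_filter]
  rw [← this]
  simp [E]
  omega

theorem E_iso_lt (h : 0 < dg G v) : E (iso G v) < E G := by
  have := E_iso (G := G) v; omega

theorem Ph_le : Ph G ≤ 3 * E G := by
  rw [Ph, E, Finset.mul_sum]
  exact Finset.sum_le_sum (fun u _ => w_le _)

/-- the main quantity -/
def Bd (G : SimpleGraph V) (c : ℕ) : Prop := ∃ k, tr G k ∧ 32 * k ≤ Ph G + c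

theorem Bd.mono {c c' : ℕ} (h : Bd G c) (hc : c ≤ c') : Bd G c' := by
  obtain ⟨k, h1, h2⟩ := h
  exact ⟨k, h1, by omega⟩

theorem Bd.del {c c' : ℕ} (h : Bd (iso G v) c') (hc : 32 + c' ≤ drop G v + c) : Bd G c := by
  obtain ⟨k, h1, h2⟩ := h
  have := Ph_iso (G := G) v
  exact ⟨k + 1, h1.of_iso, by omega⟩

theorem Bd.simp {c c' : ℕ} (hN : ∀ u, G.Adj z u → u = a ∨ u = b)
    (hz : G.Adj z a ∧ G.Adj z b) (hab : a = b ∨ G.Adj a b)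
    (h : Bd (iso G z) c') (hc : c' ≤ drop G z + c) : Bd G c := by
  obtain ⟨k, h1, h2⟩ := h
  have := Ph_iso (G := G) z
  exact ⟨k, h1.of_simp hN hz hab, by omega⟩

/-- lower bound for drops -/
theorem drop_ge {l : ℕ} (A : Finset V) (hA : ∀ u ∈ A, G.Adj v u)
    (hl : ∀ u, G.Adj v u → l ≤ dl (dg G u)) :
    w (dg G v) + ∑ u ∈ A, dl (dg G u) + l * (dg G v - A.card) ≤ drop G v := by
  have hsub : A ⊆ nb G v := fun u hu => mem_nb.2 (hA u hu)
  have h1 := Finset.sum_sdiff (f := fun u => dl (dg G u)) hsub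
  have h2 : l * (nb G v \ A).card ≤ ∑ u ∈ nb G v \ A, dl (dg G u) := by
    rw [mul_comm]
    exact Finset.card_nsmul_le_sum _ _ _ (fun u hu => hl u (mem_nb.1 (Finset.mem_sdiff.1 hu).1))
  rw [Finset.card_sdiff_of_subset hsub] at h2
  rw [drop]
  simp only [dg] at *
  omega

theorem drop_ge0 {l : ℕ} (hl : ∀ u, G.Adj v u → l ≤ dl (dg G u)) :
    w (dg G v) + l * dg G v ≤ drop G v := by
  simpa using drop_ge (G := G) (v := v) ∅ (by simp) hl

theorem drop_ge1 {l : ℕ} (ha : G.Adj v a) (hl : ∀ u, G.Adj v u → l ≤ dl (dg G u)) :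
    w (dg G v) + dl (dg G a) + l * (dg G v - 1) ≤ drop G v := by
  simpa using drop_ge (G := G) (v := v) {a} (by simpa using ha) hl

theorem drop_ge2 {l : ℕ} (ha : G.Adj v a) (hb : G.Adj v b) (hab : a ≠ b)
    (hl : ∀ u, G.Adj v u → l ≤ dl (dg G u)) :
    w (dg G v) + (dl (dg G a) + dl (dg G b)) + l * (dg G v - 2) ≤ drop G v := by
  simpa [hab] using drop_ge (G := G) (v := v) {a, b} (by simp [ha, hb]) hl

theorem drop_ge3 {l : ℕ} (ha : G.Adj v a) (hb : G.Adj v b) (hc : G.Adj v c) (hab : a ≠ b)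
    (hac : a ≠ c) (hbc : b ≠ c) (hl : ∀ u, G.Adj v u → l ≤ dl (dg G u)) :
    w (dg G v) + (dl (dg G a) + (dl (dg G b) + dl (dg G c))) + l * (dg G v - 3) ≤ drop G v := by
  simpa [hab, hac, hbc] using drop_ge (G := G) (v := v) {a, b, c} (by simp [ha, hb, hc]) hl

/-- connectivity up to isolated vertices -/
def Cn (G : SimpleGraph V) : Prop :=
  ∀ C : Set V, (∀ u ∈ C, ∀ v, G.Adj u v → v ∈ C) → (∃ u ∈ C, ∃ v, G.Adj u v) →
    ∀ u v, G.Adj u v → u ∈ C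

/-- all positive degrees are between three and five -/
def Gd (G : SimpleGraph V) : Prop := ∀ u, dg G u = 0 ∨ dg G u = 3 ∨ dg G u = 4 ∨ dg G u = 5

theorem Gd.nb (h : Gd G) (hu : G.Adj v u) : dg G u = 3 ∨ dg G u = 4 ∨ dg G u = 5 := by
  have := dg_pos' hu.symm
  rcases h u with h | h
  · omega
  · exact h

theorem Gd.l3 (h : Gd G) : ∀ u, G.Adj v u → 3 ≤ dl (dg G u) := by
  intro u hu
  rcases h.nb hu with h | h | h <;> rw [h] <;> decide

end



section
variable {V : Type*}

/-- union of two graphs meeting in at most `p` -/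
structure Sp0 (G : SimpleGraph V) (p : V) (A B : SimpleGraph V) : Prop where
  adj : ∀ u v, G.Adj u v ↔ A.Adj u v ∨ B.Adj u v
  dis : ∀ u v w, A.Adj u v → B.Adj u w → u = p

/-- a proper one-separation -/
structure Spl (G : SimpleGraph V) (p : V) (A B : SimpleGraph V) : Prop extends Sp0 G p A B where
  neA : ∃ u v, A.Adj u v
  neB : ∃ u v, B.Adj u v

variable {G A B : SimpleGraph V} {p : V}

theorem Sp0.symm (h : Sp0 G p A B) : Sp0 G p B A :=
  ⟨fun u v => (h.adj u v).trans or_comm, fun u v w h1 h2 => h.dis u w v h2 h1⟩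

theorem Spl.symm (h : Spl G p A B) : Spl G p B A := ⟨h.toSp0.symm, h.neB, h.neA⟩

theorem Sp0.nboth (h : Sp0 G p A B) {u v : V} (h1 : A.Adj u v) (h2 : B.Adj u v) : False :=
  h1.ne ((h.dis u v v h1 h2).trans (h.dis v u u h1.symm h2.symm).symm)

theorem tr.anti {H : SimpleGraph V} {k : ℕ} (h : tr G k) (hm : ∀ u v, H.Adj u v → G.Adj u v) : tr H k := by
  obtain ⟨X, hX, h⟩ := h
  exact ⟨X, hX, fun hk => h (hk.mono (by rintro a b ⟨h1, h2⟩; exact ⟨hm a b h1, h2⟩))⟩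

theorem Sp0.tr (h : Sp0 G p A B) {k l : ℕ} (h1 : tr A k) (h2 : tr B l) : tr G (k + l) := by
  refine tr.of_split (C := {u | u ≠ p ∧ ∃ v, A.Adj u v}) (p := p) (fun hp => hp.1 rfl) ?_
    (h1.anti ?_) (h2.anti ?_)
  · rintro u ⟨hup, x, hx⟩ v huv
    by_cases hv : v = p
    · exact Or.inr hv
    · refine Or.inl ⟨hv, u, ?_⟩
      rcases (h.adj u v).1 huv with h' | h'
      · exact h'.symm
      · exact absurd (h.dis u x v hx h') hup
  · rintro u v ⟨huv, hu, hv⟩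
    rcases (h.adj u v).1 huv with h' | h'
    · exact h'
    · rcases hu with hu | ⟨hu, x, hx⟩
      · rcases hv with hv | ⟨hv, x, hx⟩
        · exact absurd (hu.trans hv.symm) huv.ne
        · exact absurd (h.dis v x u hx h'.symm) hv
      · exact absurd (h.dis u x v hx h') hu
  · rintro u v ⟨huv, hu, hv⟩
    rcases (h.adj u v).1 huv with h' | h'
    · by_cases hup : u = p
      · exact absurd ⟨fun e => h'.ne (hup.trans e.symm), u, h'.symm⟩ hv
      · exact absurd ⟨hup, v, h'⟩ hu
    · exact h'

theorem Sp0.iso (h : Sp0 G p A B) : Sp0 (iso G p) p (iso A p) (iso B p) := by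
  refine ⟨fun u v => ?_, fun u v w h1 h2 => h.dis u v w h1.1 h2.1⟩
  simp only [iso_adj, h.adj]
  tauto

theorem Spl.cnA (h : Spl G p A B) (hG : Cn G) : Cn A := by
  intro D hD hne
  by_cases hp : p ∈ D
  · have := hG (D ∪ {u | ∃ v, B.Adj u v}) (by
      rintro u (hu | ⟨x, hx⟩) v huv
      · rcases (h.adj u v).1 huv with h' | h'
        · exact Or.inl (hD u hu v h')
        · exact Or.inr ⟨u, h'.symm⟩
      · rcases (h.adj u v).1 huv with h' | h'
        · have : u = p := h.dis u v x h' hx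
          exact Or.inl (hD u (this ▸ hp) v h')
        · exact Or.inr ⟨u, h'.symm⟩) (by
      obtain ⟨u, hu, v, huv⟩ := hne
      exact ⟨u, Or.inl hu, v, (h.adj u v).2 (Or.inl huv)⟩)
    intro u v huv
    rcases this u v ((h.adj u v).2 (Or.inl huv)) with h' | ⟨x, hx⟩
    · exact h'
    · exact (h.dis u v x huv hx) ▸ hp
  · have := hG {u | u ∈ D ∧ ∃ v, A.Adj u v} (by
      rintro u ⟨hu, x, hx⟩ v huv
      rcases (h.adj u v).1 huv with h' | h'
      · exact ⟨hD u hu v h', u, h'.symm⟩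
      · exact absurd (h.dis u x v hx h' ▸ hu) hp) (by
      obtain ⟨u, hu, v, huv⟩ := hne
      exact ⟨u, ⟨hu, v, huv⟩, v, (h.adj u v).2 (Or.inl huv)⟩)
    intro u v huv
    exact (this u v ((h.adj u v).2 (Or.inl huv))).1

theorem Spl.nbA (h : Spl G p A B) (hG : Cn G) : ∃ v, A.Adj p v := by
  by_contra hc
  push Not at hc
  obtain ⟨a, b, hab⟩ := h.neA
  obtain ⟨c, d, hcd⟩ := h.neB
  have := hG {u | ∃ v, A.Adj u v} (by
    rintro u ⟨x, hx⟩ v huv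
    rcases (h.adj u v).1 huv with h' | h'
    · exact ⟨u, h'.symm⟩
    · have : u = p := h.dis u x v hx h'
      exact absurd (this ▸ hx) (hc x)) ⟨a, ⟨b, hab⟩, b, (h.adj a b).2 (Or.inl hab)⟩ c d
      ((h.adj c d).2 (Or.inr hcd))
  obtain ⟨x, hx⟩ := this
  exact hc x (h.dis c x d hx hcd ▸ hx)

theorem cn_iso_or (G : SimpleGraph V) (p : V) : Cn (K4T.iso G p) ∨ ∃ A B, Spl G p A B := by
  by_contra hc
  push Not at hc
  obtain ⟨h1, h2⟩ := hc
  apply h1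
  intro C hC hne a b hab
  by_contra ha
  have hb : b ∉ C := fun hb => ha (hC b hb a hab.symm)
  refine h2 (rs G (insert p C)) (rs G (C \ {p})ᶜ) ⟨⟨fun u v => ?_, fun u v w h1 h2 => ?_⟩, ?_, ?_⟩
  · constructor
    · intro huv
      by_cases hu : u ∈ C \ {p}
      · left
        refine ⟨huv, Or.inr hu.1, ?_⟩
        by_cases hv : v = p
        · exact Or.inl hv
        · exact Or.inr (hC u hu.1 v ⟨huv, hu.2, hv⟩)
      · by_cases hv : v ∈ C \ {p}
        · left
          refine ⟨huv, ?_, Or.inr hv.1⟩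
          by_cases hup : u = p
          · exact Or.inl hup
          · exact Or.inr (hC v hv.1 u ⟨huv.symm, hv.2, hup⟩)
        · exact Or.inr ⟨huv, hu, hv⟩
    · rintro (h | h) <;> exact h.1
  · by_contra hup
    exact h2.2.1 ⟨h1.2.1.resolve_left hup, hup⟩
  · obtain ⟨u, hu, v, huv⟩ := hne
    exact ⟨u, v, huv.1, Or.inr hu, Or.inr (hC u hu v huv)⟩
  · exact ⟨a, b, hab.1, fun h => ha h.1, fun h => hb h.1⟩

/-- no one-separation -/
def Ns (G : SimpleGraph V) : Prop := ∀ p A B, ¬ Spl G p A B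

theorem Ns.cn (h : Ns G) (v : V) : Cn (K4T.iso G v) := by
  rcases cn_iso_or G v with h' | ⟨A, B, h'⟩
  · exact h'
  · exact absurd h' (h v A B)

/-- suppression preserves connectivity -/
theorem Cn.spr {z a b : V} (hG : Cn G) (hN : ∀ u, G.Adj z u → u = a ∨ u = b)
    (ha : G.Adj z a) (hb : G.Adj z b) : Cn (K4T.spr G z a b) := by
  intro C hC hne
  have hab : a ∈ C ↔ b ∈ C := by
    by_cases h : a = b
    · rw [h]
    · exact ⟨fun h' => hC a h' b (Or.inr ⟨h, Or.inl ⟨rfl, rfl⟩⟩),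
        fun h' => hC b h' a (Or.inr ⟨h, Or.inr ⟨rfl, rfl⟩⟩)⟩
  have hnz : ∀ u v, (K4T.spr G z a b).Adj u v → u ≠ z := by
    rintro u v (h | ⟨h, ⟨rfl, rfl⟩ | ⟨rfl, rfl⟩⟩)
    · exact h.2.1
    · exact ha.ne'
    · exact hb.ne'
  have hreal : ∀ u v, (K4T.spr G z a b).Adj u v → ∃ v', G.Adj u v' := by
    rintro u v (h | ⟨h, ⟨rfl, rfl⟩ | ⟨rfl, rfl⟩⟩)
    · exact ⟨v, h.1⟩
    · exact ⟨z, ha.symm⟩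
    · exact ⟨z, hb.symm⟩
  have key := hG {u | (u ≠ z ∧ u ∈ C) ∨ (u = z ∧ a ∈ C)} (by
    rintro u (⟨hu, huC⟩ | ⟨rfl, haC⟩) v huv
    · by_cases hv : v = z
      · refine Or.inr ⟨hv, ?_⟩
        rw [hv] at huv
        rcases hN u huv.symm with rfl | rfl
        · exact huC
        · exact hab.2 huC
      · exact Or.inl ⟨hv, hC u huC v (Or.inl ⟨huv, hu, hv⟩)⟩
    · refine Or.inl ⟨huv.ne', ?_⟩
      rcases hN v huv with rfl | rfl
      · exact haC
      · exact hab.1 haC) (by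
    obtain ⟨u, hu, v, huv⟩ := hne
    obtain ⟨v', hv'⟩ := hreal u v huv
    exact ⟨u, Or.inl ⟨hnz u v huv, hu⟩, v', hv'⟩)
  intro u v huv
  obtain ⟨v', hv'⟩ := hreal u v huv
  rcases key u v' hv' with h | h
  · exact h.2
  · exact absurd h.1 (hnz u v huv)

theorem spr_eq_iso {z a b : V}
    (hz : G.Adj z a ∧ G.Adj z b) (hab : a = b ∨ G.Adj a b) : K4T.spr G z a b = K4T.iso G z := by
  ext u v
  rw [spr_adj, iso_adj]
  constructor
  · rintro (h | ⟨h, h'⟩)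
    · exact h
    · rcases hab with h2 | h2
      · exact absurd h2 h
      · rcases h' with ⟨rfl, rfl⟩ | ⟨rfl, rfl⟩
        · exact ⟨h2, hz.1.ne', hz.2.ne'⟩
        · exact ⟨h2.symm, hz.2.ne', hz.1.ne'⟩
  · exact Or.inl

theorem Cn.simp {z a b : V} (hG : Cn G) (hN : ∀ u, G.Adj z u → u = a ∨ u = b)
    (hz : G.Adj z a ∧ G.Adj z b) (hab : a = b ∨ G.Adj a b) : Cn (K4T.iso G z) := by
  rw [← spr_eq_iso hz hab]
  exact hG.spr hN hz.1 hz.2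

end

section
variable {V : Type*} [Fintype V] {G A B : SimpleGraph V} {p : V}

theorem Sp0.dg (h : Sp0 G p A B) (u : V) : dg G u = dg A u + dg B u := by
  have : nb G u = nb A u ∪ nb B u := by
    ext v; simp [h.adj]
  rw [K4T.dg, this, Finset.card_union_of_disjoint]
  · rfl
  · rw [Finset.disjoint_left]
    intro v h1 h2
    exact h.nboth (mem_nb.1 h1) (mem_nb.1 h2)

theorem Sp0.dg0 (h : Sp0 G p A B) {u : V} (hu : u ≠ p) : K4T.dg A u = 0 ∨ K4T.dg B u = 0 := by
  by_contra hc
  push Not at hc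
  obtain ⟨v, hv⟩ := dg_pos.1 (Nat.pos_of_ne_zero hc.1)
  obtain ⟨x, hx⟩ := dg_pos.1 (Nat.pos_of_ne_zero hc.2)
  exact hu (h.dis u v x hv hx)

theorem Sp0.E (h : Sp0 G p A B) : E G = E A + E B := by
  simp only [K4T.E, h.dg, Finset.sum_add_distrib]

theorem Sp0.Ph (h : Sp0 G p A B) :
    Ph G + w (K4T.dg A p) + w (K4T.dg B p) = Ph A + Ph B + w (K4T.dg A p + K4T.dg B p) := by
  have key : ∀ u, w (K4T.dg G u) + (if u = p then w (K4T.dg A p) else 0)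
      + (if u = p then w (K4T.dg B p) else 0)
      = w (K4T.dg A u) + w (K4T.dg B u) + (if u = p then w (K4T.dg A p + K4T.dg B p) else 0) := by
    intro u
    by_cases hu : u = p
    · subst hu
      simp [h.dg]
      omega
    · rw [h.dg]
      rcases h.dg0 hu with h' | h' <;> simp [hu, h']
  have := Finset.sum_congr (s₁ := (Finset.univ : Finset V)) rfl (fun u _ => key u)
  simpa [Finset.sum_add_distrib, K4T.Ph] using this

theorem E_pos {u v : V} (h : G.Adj u v) : 0 < E G := by
  have h1 := dg_pos' h
  have : K4T.dg G u ≤ E G := Finset.single_le_sum (f := fun u => K4T.dg G u)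
    (fun _ _ => Nat.zero_le _) (Finset.mem_univ u)
  omega

theorem Spl.ltA (h : Spl G p A B) : E A < E G := by
  obtain ⟨u, v, huv⟩ := h.neB
  have := E_pos huv
  have := h.toSp0.E
  omega

theorem Spl.posA (h : Spl G p A B) (hG : Cn G) : 0 < dg A p := dg_pos.2 (h.nbA hG)

end



section
variable {V : Type*} [Fintype V] {G A B : SimpleGraph V} {p : V}

theorem tr_min (G : SimpleGraph V) : ∃ s, tr G s ∧ ∀ k, tr G k → s ≤ k := by
  have hex : ∃ s, tr G s := by
    refine ⟨_, Finset.univ, le_rfl, ?_⟩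
    rintro ⟨B, _, _, _, h4⟩
    obtain ⟨u, _, v, _, huv⟩ := h4 0 1 (by decide)
    exact huv.2.1 (by simp)
  exact ⟨Nat.find hex, Nat.find_spec hex, fun k hk => Nat.find_min' hex hk⟩

/-- the linear bound -/
def Mb (G : SimpleGraph V) : Prop := ∃ k, tr G k ∧ 32 * k ≤ 3 * E G + 6

theorem lemL (p : V) (m : ℕ) : ∀ A : SimpleGraph V, E A = m →
    (∀ H : SimpleGraph V, E H < m → Cn H → Mb H) → Cn A → 0 < dg A p →
    ∃ k, tr (iso A p) k ∧ 32 * k ≤ 3 * E A := by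
  induction m using Nat.strong_induction_on with
  | _ m ih =>
    intro A hA hM hcn hp
    have hE := E_iso (G := A) p
    rcases cn_iso_or A p with h | ⟨A1, A2, h⟩
    · obtain ⟨k, h1, h2⟩ := hM _ (by omega) h
      exact ⟨k, h1, by omega⟩
    · have l1 := h.ltA
      have l2 := h.symm.ltA
      obtain ⟨k1, h1, h1'⟩ := ih (E A1) (by omega) A1 rfl (fun H hH => hM H (by omega))
        (h.cnA hcn) (h.posA hcn)
      obtain ⟨k2, h2, h2'⟩ := ih (E A2) (by omega) A2 rfl (fun H hH => hM H (by omega))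
        (h.symm.cnA hcn) (h.symm.posA hcn)
      have := h.toSp0.E
      exact ⟨k1 + k2, h.toSp0.iso.tr h1 h2, by omega⟩

theorem mainM (hP : ∀ G : SimpleGraph V, Cn G → (∀ v, dg G v ≤ 5) → Bd G 6) (n : ℕ) :
    ∀ G : SimpleGraph V, E G = n → Cn G → Mb G := by
  induction n using Nat.strong_induction_on with
  | _ n ih =>
    intro G hG hcn
    by_cases hd : ∀ v, dg G v ≤ 5
    · obtain ⟨k, h1, h2⟩ := hP G hcn hd
      have := Ph_le (G := G)
      exact ⟨k, h1, by omega⟩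
    push Not at hd
    obtain ⟨v, hv⟩ := hd
    have hM : ∀ H : SimpleGraph V, E H < n → Cn H → Mb H := fun H hH => ih _ hH H rfl
    rcases cn_iso_or G v with h | ⟨A, B, h⟩
    · have hE := E_iso (G := G) v
      obtain ⟨k, h1, h2⟩ := hM _ (by omega) h
      exact ⟨k + 1, h1.of_iso, by omega⟩
    · have l1 := h.ltA
      have l2 := h.symm.ltA
      have hE := h.toSp0.E
      obtain ⟨sa, ta, ma⟩ := tr_min A
      obtain ⟨sb, tb, mb⟩ := tr_min B
      obtain ⟨ka, ia, ba⟩ := lemL v _ A rfl (fun H hH => hM H (by omega)) (h.cnA hcn) (h.posA hcn)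
      obtain ⟨kb, ib, bb⟩ := lemL v _ B rfl (fun H hH => hM H (by omega)) (h.symm.cnA hcn)
        (h.symm.posA hcn)
      obtain ⟨ja, ja1, ja2⟩ := hM A (by omega) (h.cnA hcn)
      obtain ⟨jb, jb1, jb2⟩ := hM B (by omega) (h.symm.cnA hcn)
      by_cases h1 : sa ≤ ka
      · exact ⟨sa + jb, h.toSp0.tr ta jb1, by omega⟩
      by_cases h2 : sb ≤ kb
      · exact ⟨ja + sb, h.toSp0.tr ja1 tb, by omega⟩
      have := ma _ ja1
      have := mb _ jb1
      exact ⟨ka + kb + 1, (h.toSp0.iso.tr ia ib).of_iso, by omega⟩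

theorem final (hP : ∀ G : SimpleGraph V, Cn G → (∀ v, dg G v ≤ 5) → Bd G 6)
    (G : SimpleGraph V) (hconn : G.Connected) :
    (transNum G : ℝ) ≤ (3 / 16) * ((G.edgeSet.ncard : ℝ) + 1) := by
  have hcn : Cn G := by
    intro C hC hne u v _
    obtain ⟨x, hx, _⟩ := hne
    obtain ⟨wk⟩ := hconn.preconnected x u
    clear * - hC hx wk
    induction wk with
    | nil => exact hx
    | cons h _ ih => exact ih (hC _ hx _ h)
  obtain ⟨k, h1, h2⟩ := mainM hP _ G rfl hcn
  have hE : E G = 2 * G.edgeSet.ncard := by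
    have := G.sum_degrees_eq_twice_card_edges
    have e : G.edgeSet.ncard = G.edgeFinset.card := by
      rw [← SimpleGraph.coe_edgeFinset, Set.ncard_coe_finset]
    rw [e, ← this, E]
    refine Finset.sum_congr rfl (fun u _ => ?_)
    rw [dg, ← SimpleGraph.card_neighborFinset_eq_degree]
    congr 1
    ext x
    simp
  have h3 := h1.transNum_le
  have h4 : 16 * transNum G ≤ 3 * (G.edgeSet.ncard + 1) := by omega
  have h5 : (16 : ℝ) * transNum G ≤ 3 * ((G.edgeSet.ncard : ℝ) + 1) := by exact_mod_cast h4
  linarith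

end


section
variable {V : Type*} [Fintype V] {G H : SimpleGraph V} {p : V}

/-- feature: a vertex of degree five adjacent to one of degree three -/
def F1 (G : SimpleGraph V) : Prop := ∃ v h, G.Adj v h ∧ dg G v = 5 ∧ dg G h = 3

/-- feature -/
def E1 (G : SimpleGraph V) : Prop := ∃ c g g' d, g ≠ g' ∧ g ≠ d ∧ g' ≠ d ∧
  G.Adj c g ∧ G.Adj c g' ∧ G.Adj c d ∧ dg G c = 4 ∧ dg G g = 3 ∧ dg G g' = 3 ∧
  (dg G d = 3 ∨ dg G d = 4)

/-- feature -/
def E2 (G : SimpleGraph V) : Prop := ∃ g a c d, G.Adj g a ∧ G.Adj g c ∧ G.Adj g d ∧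
  G.Adj a c ∧ G.Adj a d ∧ G.Adj c d ∧ dg G g = 3 ∧ dg G a = 4 ∧ dg G c = 4 ∧ dg G d = 4

/-- feature -/
def E3 (G : SimpleGraph V) : Prop := ∃ x g q c d, q ≠ g ∧ G.Adj x g ∧ G.Adj x q ∧
  G.Adj g c ∧ G.Adj g d ∧ G.Adj c d ∧ dg G x = 3 ∧ dg G g = 3 ∧ dg G q = 3 ∧
  dg G c = 4 ∧ dg G d = 4

/-- features -/
def Feat (G : SimpleGraph V) : Prop := F1 G ∨ E1 G ∨ E2 G ∨ E3 G

theorem Feat.three (h : Feat G) : ∃ v, dg G v = 3 := by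
  rcases h with h | h | h | h
  · obtain ⟨v, h, h1, h2, h3⟩ := h
    exact ⟨h, h3⟩
  · obtain ⟨c, g, g', d, h⟩ := h
    exact ⟨g, by tauto⟩
  · obtain ⟨g, a, c, d, h⟩ := h
    exact ⟨g, by tauto⟩
  · obtain ⟨x, g, q, c, d, h⟩ := h
    exact ⟨x, by tauto⟩

/-- the induction package -/
structure Pack (G : SimpleGraph V) : Prop where
  p6 : Bd G 6
  p4 : (∃ v, dg G v = 3 ∨ dg G v = 4) → Bd G 4
  p3 : (∃ v, dg G v = 3) → Bd G 3
  p1 : Feat G → Bd G 1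
  p0 : (∀ v, dg G v ≠ 5) → ((∃ v, dg G v = 3) ∨ ∀ v, dg G v ≠ 4) → Bd G 0

theorem Pack.of0 (h : Bd G 0) : Pack G :=
  ⟨h.mono (by omega), fun _ => h.mono (by omega), fun _ => h.mono (by omega),
    fun _ => h.mono (by omega), fun _ _ => h⟩

theorem Pack.of1 (h : Bd G 1) {v : V} (hv : dg G v = 5) : Pack G :=
  ⟨h.mono (by omega), fun _ => h.mono (by omega), fun _ => h.mono (by omega),
    fun _ => h, fun h5 => absurd hv (h5 v)⟩

theorem Feat.transfer (hdeg : ∀ u, 3 ≤ dg G u → dg H u = dg G u)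
    (hadj : ∀ u v, 3 ≤ dg G u → 3 ≤ dg G v → G.Adj u v → H.Adj u v) (h : Feat G) : Feat H := by
  have hd : ∀ u n, dg G u = n → 3 ≤ n → dg H u = n := fun u n h1 h2 => by
    rw [hdeg u (by omega), h1]
  rcases h with h | h | h | h
  · obtain ⟨v, h, h1, h2, h3⟩ := h
    exact Or.inl ⟨v, h, hadj _ _ (by omega) (by omega) h1, hd _ _ h2 (by omega), hd _ _ h3 (by omega)⟩
  · obtain ⟨c, g, g', d, n1, n2, n3, a1, a2, a3, d1, d2, d3, d4⟩ := h
    refine Or.inr (Or.inl ⟨c, g, g', d, n1, n2, n3, hadj _ _ (by omega) (by omega) a1,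
      hadj _ _ (by omega) (by omega) a2, hadj _ _ (by omega) (by omega) a3,
      hd _ _ d1 (by omega), hd _ _ d2 (by omega), hd _ _ d3 (by omega), ?_⟩)
    rw [hdeg d (by omega)]
    exact d4
  · obtain ⟨g, a, c, d, a1, a2, a3, a4, a5, a6, d1, d2, d3, d4⟩ := h
    exact Or.inr (Or.inr (Or.inl ⟨g, a, c, d, hadj _ _ (by omega) (by omega) a1,
      hadj _ _ (by omega) (by omega) a2, hadj _ _ (by omega) (by omega) a3,
      hadj _ _ (by omega) (by omega) a4, hadj _ _ (by omega) (by omega) a5,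
      hadj _ _ (by omega) (by omega) a6,
      hd _ _ d1 (by omega), hd _ _ d2 (by omega), hd _ _ d3 (by omega), hd _ _ d4 (by omega)⟩))
  · obtain ⟨x, g, q, c, d, n1, a1, a2, a3, a4, a5, d1, d2, d3, d4, d5⟩ := h
    exact Or.inr (Or.inr (Or.inr ⟨x, g, q, c, d, n1, hadj _ _ (by omega) (by omega) a1,
      hadj _ _ (by omega) (by omega) a2, hadj _ _ (by omega) (by omega) a3,
      hadj _ _ (by omega) (by omega) a4, hadj _ _ (by omega) (by omega) a5,
      hd _ _ d1 (by omega), hd _ _ d2 (by omega), hd _ _ d3 (by omega), hd _ _ d4 (by omega),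
      hd _ _ d5 (by omega)⟩))

theorem Pack.transfer (hdeg : ∀ u, 3 ≤ dg G u → dg H u = dg G u)
    (hdeg' : ∀ u, dg H u ≤ dg G u)
    (hadj : ∀ u v, 3 ≤ dg G u → 3 ≤ dg G v → G.Adj u v → H.Adj u v)
    (hB : ∀ c, Bd H c → Bd G c) (h : Pack H) : Pack G := by
  have hd : ∀ u n, dg G u = n → 3 ≤ n → dg H u = n := fun u n h1 h2 => by
    rw [hdeg u (by omega), h1]
  have hd' : ∀ u n, dg H u = n → 3 ≤ n → dg G u = n := fun u n h1 h2 => by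
    have := hdeg' u
    rw [← hdeg u (by omega), h1]
  refine ⟨hB _ h.p6, ?_, ?_, ?_, ?_⟩
  · rintro ⟨v, hv⟩
    refine hB _ (h.p4 ⟨v, ?_⟩)
    rw [hdeg v (by omega)]
    exact hv
  · rintro ⟨v, hv⟩
    exact hB _ (h.p3 ⟨v, hd _ _ hv (by omega)⟩)
  · intro hf
    exact hB _ (h.p1 (hf.transfer hdeg hadj))
  · intro h5 h34
    refine hB _ (h.p0 (fun v hv => h5 v (hd' _ _ hv (by omega))) ?_)
    rcases h34 with ⟨v, hv⟩ | h4
    · exact Or.inl ⟨v, hd _ _ hv (by omega)⟩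
    · exact Or.inr (fun v hv => h4 v (hd' _ _ hv (by omega)))

/-- maximum degree at most five -/
def M5 (G : SimpleGraph V) : Prop := ∀ v, dg G v ≤ 5

theorem M5.mono (h : M5 G) (hd : ∀ v, dg H v ≤ dg G v) : M5 H := fun v => (hd v).trans (h v)

theorem M5.iso (h : M5 G) (v : V) : M5 (iso G v) := h.mono (fun _ => dg_iso_le)

/-- induction hypothesis -/
def IH (n : ℕ) (V : Type*) [Fintype V] : Prop :=
  ∀ H : SimpleGraph V, E H < n → Cn H → M5 H → Pack H

theorem dg_spr {z a b u : V} (hN : ∀ u, G.Adj z u → u = a ∨ u = b)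
    (ha : G.Adj z a) (hb : G.Adj z b) (hab : a ≠ b) (hnab : ¬ G.Adj a b) (hu : u ≠ z) :
    dg (spr G z a b) u = dg G u := by
  by_cases hua : u = a
  · subst hua
    have : nb (spr G z u b) u = insert b ((nb G u).erase z) := by
      ext x
      simp only [mem_nb, spr_adj, Finset.mem_insert, Finset.mem_erase]
      constructor
      · rintro (h | ⟨_, h | h⟩)
        · exact Or.inr ⟨h.2.2, h.1⟩
        · exact Or.inl h.2
        · exact absurd h.1 hab
      · rintro (h | h)
        · exact Or.inr ⟨hab, Or.inl ⟨by trivial, h⟩⟩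
        · exact Or.inl ⟨h.2, hu, h.1⟩
    rw [dg, this, Finset.card_insert_of_notMem (by simp [hnab]),
      Finset.card_erase_add_one (mem_nb.2 ha.symm), dg]
  by_cases hub : u = b
  · subst hub
    have : nb (spr G z a u) u = insert a ((nb G u).erase z) := by
      ext x
      simp only [mem_nb, spr_adj, Finset.mem_insert, Finset.mem_erase]
      constructor
      · rintro (h | ⟨_, h | h⟩)
        · exact Or.inr ⟨h.2.2, h.1⟩
        · exact absurd h.1 hua
        · exact Or.inl h.2
      · rintro (h | h)
        · exact Or.inr ⟨hab, Or.inr ⟨by trivial, h⟩⟩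
        · exact Or.inl ⟨h.2, hu, h.1⟩
    rw [dg, this, Finset.card_insert_of_notMem (by simp [G.adj_comm u a, hnab]),
      Finset.card_erase_add_one (mem_nb.2 hb.symm), dg]
  · apply dg_congr
    intro x
    rw [spr_adj]
    constructor
    · rintro (h | ⟨_, h | h⟩)
      · exact h.1
      · exact absurd h.1 hua
      · exact absurd h.1 hub
    · intro h
      refine Or.inl ⟨h, hu, ?_⟩
      rintro rfl
      rcases hN u h.symm with h | h
      · exact hua h
      · exact hub h

theorem stepR (hcn : Cn G) (h5 : M5 G) (ih : IH (E G) V) {z : V}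
    (hz : dg G z = 1 ∨ dg G z = 2) : Pack G := by
  have hex : ∃ a b, G.Adj z a ∧ G.Adj z b ∧ ∀ u, G.Adj z u → u = a ∨ u = b := by
    rcases hz with h | h
    · obtain ⟨a, ha⟩ := Finset.card_eq_one.1 h
      have : ∀ u, G.Adj z u ↔ u = a := fun u => by rw [← mem_nb, ha]; simp
      exact ⟨a, a, (this a).2 rfl, (this a).2 rfl, fun u hu => Or.inl ((this u).1 hu)⟩
    · obtain ⟨a, b, _, ha⟩ := Finset.card_eq_two.1 h
      have : ∀ u, G.Adj z u ↔ u = a ∨ u = b := fun u => by rw [← mem_nb, ha]; simp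
      exact ⟨a, b, (this a).2 (Or.inl rfl), (this b).2 (Or.inr rfl), fun u hu => (this u).1 hu⟩
  obtain ⟨a, b, ha, hb, hN⟩ := hex
  have hwz : w (dg G z) = 0 := by rcases hz with h | h <;> rw [h] <;> rfl
  by_cases hab : a = b ∨ G.Adj a b
  · have hP : Pack (iso G z) := ih _ (E_iso_lt (dg_pos' ha)) (hcn.simp hN ⟨ha, hb⟩ hab) (h5.iso z)
    have hBd : ∀ c c', Bd (iso G z) c' → c' ≤ drop G z + c → Bd G c := fun c c' h1 h2 =>
      Bd.simp hN ⟨ha, hb⟩ hab h1 h2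
    by_cases hy : ∃ y, G.Adj z y ∧ 3 ≤ dg G y
    · obtain ⟨y, hzy, hy⟩ := hy
      have hdr := drop_ge1 (l := 0) hzy (fun _ _ => Nat.zero_le _)
      have hd := dg_iso_adj hzy
      have hy5 := h5 y
      have : dg G y = 3 ∨ dg G y = 4 ∨ dg G y = 5 := by omega
      rcases this with h | h | h
      · rw [h, dl3] at hdr
        exact Pack.of0 (hBd _ _ hP.p6 (by omega))
      · rw [h, dl4] at hdr
        exact Pack.of0 (hBd _ _ (hP.p3 ⟨y, by omega⟩) (by omega))
      · rw [h, dl5] at hdr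
        exact Pack.of1 (hBd _ _ (hP.p4 ⟨y, by omega⟩) (by omega)) h
    · push Not at hy
      have hz3 : ∀ u, 3 ≤ dg G u → u ≠ z := by
        rintro u hu rfl
        omega
      refine hP.transfer ?_ (fun _ => dg_iso_le) ?_ (fun c h => hBd c c h (by omega))
      · intro u hu
        refine dg_iso_nadj (hz3 u hu) (fun h => ?_)
        have := hy u h
        omega
      · intro u v hu hv huv
        exact ⟨huv, hz3 u hu, hz3 v hv⟩
  · push Not at hab
    have hdu : ∀ u, u ≠ z → dg (spr G z a b) u = dg G u := fun u hu =>
      dg_spr hN ha hb hab.1 hab.2 hu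
    have hdz : dg (spr G z a b) z = 0 := by
      apply dg_zero
      rintro u (h | ⟨_, h | h⟩)
      · exact h.2.1 rfl
      · exact ha.ne h.1
      · exact hb.ne h.1
    have hle : ∀ u, dg (spr G z a b) u ≤ dg G u := by
      intro u
      by_cases hu : u = z
      · rw [hu, hdz]; omega
      · rw [hdu u hu]
    have hE : E (spr G z a b) < E G := by
      apply Finset.sum_lt_sum (fun u _ => hle u)
      exact ⟨z, Finset.mem_univ _, by rw [hdz]; omega⟩
    have hPh : Ph (spr G z a b) = Ph G := by
      apply Finset.sum_congr rfl
      intro u _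
      by_cases hu : u = z
      · rw [hu, hdz, hwz]; rfl
      · rw [hdu u hu]
    have hP : Pack (spr G z a b) := ih _ hE (hcn.spr hN ha hb) (h5.mono hle)
    have hz3 : ∀ u, 3 ≤ dg G u → u ≠ z := by
      rintro u hu rfl
      omega
    refine hP.transfer ?_ hle ?_ ?_
    · intro u hu
      exact hdu u (hz3 u hu)
    · intro u v hu hv huv
      exact Or.inl ⟨huv, hz3 u hu, hz3 v hv⟩
    · rintro c ⟨k, h1, h2⟩
      exact ⟨k, h1.of_spr hN, by omega⟩

end


section
variable {V : Type*} [Fintype V] {G A B A1 A2 H : SimpleGraph V} {p : V}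

/-- a separation with a single edge on one side -/
def Osep (G : SimpleGraph V) : Prop := ∃ p A B, Spl G p A B ∧ dg A p = 1


theorem Spl.assoc (h : Spl G p A B) (h' : Spl A p A1 A2) : Spl G p A1 (A2 ⊔ B) := by
  refine ⟨⟨fun u v => ?_, ?_⟩, h'.neA, ?_⟩
  · rw [h.adj, h'.adj, SimpleGraph.sup_adj, or_assoc]
  · rintro u v x h1 (h2 | h2)
    · exact h'.dis u v x h1 h2
    · exact h.dis u v x ((h'.adj u v).2 (Or.inl h1)) h2
  · obtain ⟨u, v, huv⟩ := h'.neB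
    exact ⟨u, v, Or.inl huv⟩

theorem lemQ (hcn : Cn G) (ho : ¬ Osep G) (h : Spl G p A B) (hd : dg A p ≤ 3) : Cn (iso A p) := by
  rcases cn_iso_or A p with h' | ⟨A1, A2, h'⟩
  · exact h'
  · exfalso
    have hA := h.cnA hcn
    have e := h'.toSp0.dg p
    have p1 := h'.posA hA
    have p2 := h'.symm.posA hA
    by_cases h1 : dg A1 p = 1
    · exact ho ⟨p, _, _, h.assoc h', h1⟩
    · exact ho ⟨p, _, _, h.assoc h'.symm, by omega⟩

/-- conclusion of the separation lemma -/
structure SC (G : SimpleGraph V) : Prop where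
  b2 : Bd G 2
  b1 : (∃ v, dg G v = 3) → Bd G 1
  b0 : (∀ v, dg G v ≠ 5) → Bd G 0

theorem SC.of0 (h : Bd G 0) : SC G := ⟨h.mono (by omega), fun _ => h.mono (by omega), fun _ => h⟩

theorem side (hP : Pack H) {n : ℕ} {y : V} (hy : dg H y + 1 = n) (hn : n = 3 ∨ n = 4 ∨ n = 5) :
    ∃ k, tr H k ∧ 32 * k ≤ Ph H + dl n + 1 ∧
      ((n ≠ 5 ∨ ∃ v, dg H v = 3) → 32 * k ≤ Ph H + dl n) := by
  rcases hn with h | h | h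
  · obtain ⟨k, h1, h2⟩ := hP.p6
    subst h
    exact ⟨k, h1, by simp; omega, fun _ => by simp; omega⟩
  · obtain ⟨k, h1, h2⟩ := hP.p3 ⟨y, by omega⟩
    subst h
    exact ⟨k, h1, by simp; omega, fun _ => by simp; omega⟩
  · by_cases h3 : ∃ v, dg H v = 3
    · obtain ⟨k, h1, h2⟩ := hP.p3 h3
      subst h
      exact ⟨k, h1, by simp; omega, fun _ => by simp; omega⟩
    · obtain ⟨k, h1, h2⟩ := hP.p4 ⟨y, by omega⟩
      subst h
      exact ⟨k, h1, by simp; omega, fun h => by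
        rcases h with h | h
        · exact absurd rfl h
        · exact absurd h h3⟩

theorem Sp0.dgA (h : Sp0 G p A B) {u v : V} (hu : u ≠ p) (huv : A.Adj u v) :
    K4T.dg A u = K4T.dg G u := by
  have := dg_pos' huv
  have e := h.dg u
  rcases h.dg0 hu with h | h <;> omega

theorem Sp0.leA (h : Sp0 G p A B) (u : V) : K4T.dg A u ≤ K4T.dg G u := by
  have e := h.dg u
  omega

theorem sepO (hcn : Cn G) (h5 : M5 G) (hgd : Gd G) (ih : IH (E G) V) (h : Spl G p A B)
    (h1 : dg A p = 1) : SC G := by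
  have hA := h.cnA hcn
  have hB := h.symm.cnA hcn
  obtain ⟨y, hy⟩ := dg_pos.1 (show 0 < dg A p by omega)
  have hN : ∀ u, A.Adj p u → u = y ∨ u = y := by
    intro u hu
    left
    exact Finset.card_le_one.1 h1.le u (mem_nb.2 hu) y (mem_nb.2 hy)
  have lA := h.ltA
  have lB := h.symm.ltA
  have lA' := E_iso_lt (G := A) (v := p) (by omega)
  have h5A : M5 A := h5.mono h.toSp0.leA
  have PA : Pack (iso A p) := ih _ (by omega) (hA.simp hN ⟨hy, hy⟩ (Or.inl rfl)) (h5A.iso p)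
  have PB : Pack B := ih _ lB hB (h5.mono h.symm.toSp0.leA)
  have hyp : y ≠ p := hy.ne'
  have dAy : dg A y = dg G y := h.dgA hyp hy.symm
  have dA'y := dg_iso_adj hy
  have dp := h.toSp0.dg p
  have hB1 := h.symm.posA hcn
  have hyn : dg G y = 3 ∨ dg G y = 4 ∨ dg G y = 5 := hgd.nb ((h.adj p y).2 (Or.inl hy))
  have hpn : dg G p = 3 ∨ dg G p = 4 ∨ dg G p = 5 := by
    have := hgd p; omega
  obtain ⟨ka, ta, ba, ba'⟩ := side PA (y := y) (n := dg G y) (by omega) hyn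
  obtain ⟨kb, tb, bb, bb'⟩ := side PB (y := p) (n := dg G p) (by omega) hpn
  have ePh := h.toSp0.Ph
  have ePA := Ph_iso (G := A) p
  have hdr := drop_ge1 (l := 0) hy (fun _ _ => Nat.zero_le _)
  have ew := w_dl (dg B p)
  rw [h1, add_comm 1, ew, show dg B p + 1 = dg G p by omega] at ePh
  rw [dAy] at hdr
  simp only [w1] at ePh
  have htr : tr G (ka + kb) := h.toSp0.tr (ta.of_simp hN ⟨hy, hy⟩ (Or.inl rfl)) tb
  refine ⟨⟨_, htr, by omega⟩, ?_, ?_⟩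
  · rintro ⟨u, hu⟩
    by_cases hup : u = p
    · subst hup
      have := bb' (Or.inl (by omega))
      exact ⟨_, htr, by omega⟩
    by_cases huy : u = y
    · subst huy
      have := ba' (Or.inl (by omega))
      exact ⟨_, htr, by omega⟩
    have e := h.toSp0.dg u
    rcases h.toSp0.dg0 hup with h' | h'
    · have := bb' (Or.inr ⟨u, by omega⟩)
      exact ⟨_, htr, by omega⟩
    · have e2 : dg (iso A p) u = dg A u := dg_iso_nadj hup (fun hh => by
        rcases hN u hh with h | h <;> exact huy h)
      have := ba' (Or.inr ⟨u, by omega⟩)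
      exact ⟨_, htr, by omega⟩
  · intro hno
    have := ba' (Or.inl (hno y))
    have := bb' (Or.inl (hno p))
    exact ⟨_, htr, by omega⟩

theorem sep32 (hcn : Cn G) (h5 : M5 G) (hgd : Gd G) (ih : IH (E G) V) (ho : ¬ Osep G)
    (h : Spl G p A B) (h1 : dg A p = 3) (h2 : dg B p = 2) : Bd G 0 := by
  have hA := h.cnA hcn
  have hB := h.symm.cnA hcn
  have lA := h.ltA
  have lB := h.symm.ltA
  have h5A : M5 A := h5.mono h.toSp0.leA
  have h5B : M5 B := h5.mono h.symm.toSp0.leA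
  have PA : Pack A := ih _ lA hA h5A
  have PB : Pack B := ih _ lB hB h5B
  have ePh := h.toSp0.Ph
  rw [h1, h2] at ePh
  simp only [w3, w2, w5, Nat.reduceAdd] at ePh
  obtain ⟨ka, ta, ba⟩ := PA.p3 ⟨p, h1⟩
  by_cases h34 : ∃ v, dg B v = 3 ∨ dg B v = 4
  · obtain ⟨kb, tb, bb⟩ := PB.p4 h34
    exact ⟨_, h.toSp0.tr ta tb, by omega⟩
  push Not at h34
  have lA' := E_iso_lt (G := A) (v := p) (by omega)
  have lB' := E_iso_lt (G := B) (v := p) (by omega)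
  have PA' : Pack (iso A p) := ih _ (by omega) (lemQ hcn ho h (by omega)) (h5A.iso p)
  have PB' : Pack (iso B p) := ih _ (by omega) (lemQ hcn ho h.symm (by omega)) (h5B.iso p)
  have ePA := Ph_iso (G := A) p
  have ePB := Ph_iso (G := B) p
  have dB : ∀ u, B.Adj p u → dg B u = 5 := by
    intro u hu
    have e1 := h.symm.toSp0.dgA hu.ne' hu.symm
    have e2 := hgd.nb ((h.adj p u).2 (Or.inr hu))
    have e3 := h34 u
    omega
  have dA : ∀ u, A.Adj p u → 3 ≤ dl (dg A u) := by
    intro u hu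
    rw [h.toSp0.dgA hu.ne' hu.symm]
    exact hgd.l3 u ((h.adj p u).2 (Or.inl hu))
  have drA := drop_ge0 dA
  have drB := drop_ge0 (G := B) (v := p) (l := 3) (fun u hu => by rw [dB u hu]; decide)
  rw [h1, w3] at drA
  rw [h2, w2] at drB
  obtain ⟨y, hy⟩ := dg_pos.1 (show 0 < dg B p by omega)
  obtain ⟨t2, tt2, bt2⟩ := PB'.p4 ⟨y, Or.inr (dg_iso_adj' hy (dB y hy))⟩
  obtain ⟨t1, tt1, bt1⟩ := PA'.p6
  obtain ⟨s2, ts2, ms2⟩ := tr_min B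
  by_cases hs : s2 ≤ t2
  · exact ⟨_, h.toSp0.tr ta ts2, by omega⟩
  · obtain ⟨k2, tk2, bk2⟩ := PB.p6
    have := ms2 _ tk2
    exact ⟨_, (h.toSp0.iso.tr tt1 tt2).of_iso, by omega⟩

theorem sepL (hcn : Cn G) (h5 : M5 G) (hgd : Gd G) (ih : IH (E G) V) (hs : ¬ Ns G) : SC G := by
  by_cases ho : Osep G
  · obtain ⟨p, A, B, h, h1⟩ := ho
    exact sepO hcn h5 hgd ih h h1
  rw [Ns] at hs
  push Not at hs
  obtain ⟨p, A, B, h⟩ := hs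
  apply SC.of0
  have p1 := h.posA hcn
  have p2 := h.symm.posA hcn
  have n1 : dg A p ≠ 1 := fun e => ho ⟨p, A, B, h, e⟩
  have n2 : dg B p ≠ 1 := fun e => ho ⟨p, B, A, h.symm, e⟩
  have e := h.toSp0.dg p
  have := h5 p
  by_cases hA : dg A p = 3
  · exact sep32 hcn h5 hgd ih ho h hA (by omega)
  by_cases hB : dg B p = 3
  · exact sep32 hcn h5 hgd ih ho h.symm hB (by omega)
  have hA : dg A p = 2 := by omega
  have hB : dg B p = 2 := by omega
  obtain ⟨ka, ta, ba⟩ := (ih _ h.ltA (h.cnA hcn) (h5.mono h.toSp0.leA)).p6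
  obtain ⟨kb, tb, bb⟩ := (ih _ h.symm.ltA (h.symm.cnA hcn) (h5.mono h.symm.toSp0.leA)).p6
  have ePh := h.toSp0.Ph
  rw [hA, hB] at ePh
  simp only [w2, w4, Nat.reduceAdd] at ePh
  exact ⟨_, h.toSp0.tr ta tb, by omega⟩

end


section
variable {V : Type*} [Fintype V] {G : SimpleGraph V}

theorem IH.mono {n m : ℕ} (h : IH n V) (hm : m ≤ n) : IH m V := fun H hH => h H (by omega)

/-- the standing assumptions in the two-connected case -/
structure Ctx (G : SimpleGraph V) : Prop where
  cn : Cn G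
  m5 : M5 G
  gd : Gd G
  ns : Ns G
  ih : IH (E G) V

theorem Ctx.pk (c : Ctx G) {v u : V} (h : G.Adj v u) : Pack (iso G v) :=
  c.ih _ (E_iso_lt (dg_pos' h)) (c.ns.cn v) (c.m5.iso v)

theorem cross (hcn : Cn G) (P : V → Prop) {u v : V} (hu : P u) (hu' : 0 < dg G u)
    (hv : ¬ P v) (hv' : 0 < dg G v) : ∃ a b, G.Adj a b ∧ P a ∧ ¬ P b := by
  by_contra hc
  push Not at hc
  obtain ⟨u', hu'⟩ := dg_pos.1 hu'
  obtain ⟨v', hv'⟩ := dg_pos.1 hv'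
  exact hv (hcn {u | P u} (fun a ha b hab => hc a b hab ha) ⟨u, hu, u', hu'⟩ v v' hv')

theorem nb_of_card {v : V} (A : Finset V) (hA : ∀ u ∈ A, G.Adj v u) (hc : dg G v ≤ A.card) :
    ∀ u, G.Adj v u → u ∈ A := by
  intro u hu
  have : A = nb G v := Finset.eq_of_subset_of_card_le (fun u hu => mem_nb.2 (hA u hu)) hc
  rw [this]
  exact mem_nb.2 hu

theorem two_nb {z a b : V} (hz : dg G z = 2) (ha : G.Adj z a) (hb : G.Adj z b) (hab : a ≠ b) :
    ∀ u, G.Adj z u → u = a ∨ u = b := by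
  intro u hu
  have := nb_of_card (G := G) (v := z) {a, b} (by simp [ha, hb]) (by
    rw [Finset.card_pair hab, hz]) u hu
  simpa using this

/-- delete `v`, then remove the vertex `z` which has become of degree two -/
theorem Ctx.del_simp (c : Ctx G) {v z a b : V} (hvz : G.Adj v z) (hz : dg (iso G v) z = 2)
    (ha : (iso G v).Adj z a) (hb : (iso G v).Adj z b) (hab : (iso G v).Adj a b) :
    Pack (iso (iso G v) z) ∧ ∀ k l, Bd (iso (iso G v) z) l →
      32 + l ≤ drop G v + (dl (dg (iso G v) a) + dl (dg (iso G v) b)) + k → Bd G k := by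
  have hN := two_nb hz ha hb hab.ne
  have l1 := E_iso_lt (dg_pos' hvz)
  have l2 := E_iso_lt (dg_pos' ha)
  refine ⟨c.ih _ (by omega) ((c.ns.cn v).simp hN ⟨ha, hb⟩ (Or.inr hab)) ((c.m5.iso v).iso z), ?_⟩
  rintro k l ⟨j, h1, h2⟩ hle
  have e1 := Ph_iso (G := G) v
  have e2 := Ph_iso (G := iso G v) z
  have e3 := drop_ge2 (l := 0) ha hb hab.ne (fun _ _ => Nat.zero_le _)
  exact ⟨j + 1, (h1.of_simp hN ⟨ha, hb⟩ (Or.inr hab)).of_iso, by omega⟩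

theorem featL (c : Ctx G) (hf : Feat G) : Bd G 1 := by
  rcases hf with hf | hf | hf | hf
  · obtain ⟨v, h, hvh, dv, dh⟩ := hf
    have dr := drop_ge1 hvh c.gd.l3
    rw [dv, dh] at dr
    simp only [w5, dl3] at dr
    by_cases hy : ∃ y, G.Adj v y ∧ dg G y ≠ 3
    · obtain ⟨y, hvy, hy⟩ := hy
      have := dg_iso_adj hvy
      have := c.gd.nb hvy
      exact ((c.pk hvy).p4 ⟨y, by omega⟩).del (by omega)
    · push Not at hy
      have dr := drop_ge0 (G := G) (v := v) (l := 8) (fun u hu => by rw [hy u hu]; decide)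
      rw [dv, w5] at dr
      exact (c.pk hvh).p6.del (by omega)
  · obtain ⟨x, g, g', d, n1, n2, n3, a1, a2, a3, d1, d2, d3, d4⟩ := hf
    have dr := drop_ge3 a1 a2 a3 n1 n2 n3 c.gd.l3
    rcases d4 with d4 | d4
    · rw [d1, d2, d3, d4] at dr
      simp only [w4, dl3] at dr
      exact (c.pk a1).p6.del (by omega)
    · rw [d1, d2, d3, d4] at dr
      simp only [w4, dl3, dl4] at dr
      exact ((c.pk a1).p3 ⟨d, dg_iso_adj' a3 d4⟩).del (by omega)
  · obtain ⟨g, a, x, d, a1, a2, a3, a4, a5, a6, d1, d2, d3, d4⟩ := hf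
    have dr := drop_ge3 a1.symm a4 a5 a2.ne a3.ne a6.ne c.gd.l3
    rw [d1, d2, d3, d4] at dr
    simp only [w4, dl3, dl4] at dr
    obtain ⟨hP, hB⟩ := c.del_simp (a := x) (b := d) a1.symm (dg_iso_adj' a1.symm d1)
      ⟨a2, a1.ne, a4.ne'⟩ ⟨a3, a1.ne, a5.ne'⟩ ⟨a6, a4.ne', a5.ne'⟩
    refine hB _ _ hP.p6 ?_
    rw [dg_iso_adj' a4 d3, dg_iso_adj' a5 d4]
    simp only [dl3]
    omega
  · obtain ⟨x, g, q, y, d, n1, a1, a2, a3, a4, a5, d1, d2, d3, d4, d5⟩ := hf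
    have dr := drop_ge2 a1 a2 n1.symm c.gd.l3
    rw [d1, d2, d3] at dr
    simp only [w3, dl3] at dr
    have yx : y ≠ x := by rintro rfl; omega
    have dx : d ≠ x := by rintro rfl; omega
    obtain ⟨hP, hB⟩ := c.del_simp (a := y) (b := d) a1 (dg_iso_adj' a1 d2)
      ⟨a3, a1.ne', yx⟩ ⟨a4, a1.ne', dx⟩ ⟨a5, yx, dx⟩
    have aux : ∀ y, y ≠ x → dg G y = 4 → 4 ≤ dl (dg (iso G x) y) ∧
        (G.Adj x y → dl (dg (iso G x) y) = 8) ∧ (¬ G.Adj x y → dg (iso G x) y = 4) := by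
      intro y yx hy
      by_cases h : G.Adj x y
      · rw [dg_iso_adj' h hy]
        simp [h]
      · rw [dg_iso_nadj yx h, hy]
        simp [h]
    obtain ⟨y1, y2, y3⟩ := aux y yx d4
    obtain ⟨e1, e2, e3⟩ := aux d dx d5
    by_cases hy : G.Adj x y
    · have := y2 hy
      exact hB _ _ hP.p6 (by omega)
    · have hy4 := y3 hy
      refine hB _ _ (hP.p3 ⟨y, dg_iso_adj' ⟨a3, a1.ne', yx⟩ hy4⟩) (by omega)

theorem n_no5 (c : Ctx G) (h5 : ∀ v, dg G v ≠ 5) {u0 u1 : V} (h0 : G.Adj u0 u1) : Pack G := by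
  have n5 : ∀ v u, dg (iso G v) u ≠ 5 := by
    intro v u hu
    have := dg_iso_le (G := G) (v := v) (u := u)
    have := c.m5 u
    have := h5 u
    omega
  by_cases h4 : ∀ v, dg G v ≠ 4
  · have h3 : ∀ v u, G.Adj v u → dg G u = 3 := fun v u h => by
      have := c.gd.nb h
      have := h4 u
      have := h5 u
      omega
    have dr := drop_ge0 (G := G) (v := u0) (l := 8) (fun u hu => by rw [h3 _ u hu]; decide)
    rw [h3 _ _ h0.symm, w3] at dr
    refine Pack.of0 (((c.pk h0).p0 (n5 u0) (Or.inr ?_)).del (by omega))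
    intro v hv
    have := dg_iso_le (G := G) (v := u0) (u := v)
    have := c.m5 v
    have := h4 v
    have := h5 v
    omega
  push Not at h4
  obtain ⟨x, hx⟩ := h4
  by_cases h3 : ∃ v, dg G v = 3
  · obtain ⟨q, hq⟩ := h3
    obtain ⟨v, h, hvh, dv, dh⟩ := cross c.cn (fun u => dg G u = 4) hx (by omega)
      (v := q) (by omega) (by omega)
    have dh : dg G h = 3 := by
      have := c.gd.nb hvh
      have := h5 h
      omega
    by_cases hy : ∃ y, G.Adj v y ∧ dg G y = 4
    · obtain ⟨y, hvy, dy⟩ := hy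
      have dr := drop_ge1 (l := 4) hvh (fun u hu => by
        have := h5 u
        rcases c.gd.nb hu with h | h | h
        · rw [h]; decide
        · rw [h]; decide
        · omega)
      rw [dv, dh] at dr
      simp only [w4, dl3] at dr
      exact Pack.of0 (((c.pk hvh).p0 (n5 v) (Or.inl ⟨y, dg_iso_adj' hvy dy⟩)).del (by omega))
    · push Not at hy
      have dr := drop_ge0 (G := G) (v := v) (l := 8) (fun u hu => by
        have := h5 u
        have := hy u hu
        rcases c.gd.nb hu with h | h | h
        · rw [h]; decide
        · omega
        · omega)
      rw [dv, w4] at dr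
      exact Pack.of0 ((c.pk hvh).p6.del (by omega))
  · push Not at h3
    have hd4 : ∀ v u, G.Adj v u → dg G u = 4 := fun v u h => by
      have := c.gd.nb h
      have := h3 u
      have := h5 u
      omega
    have dr := drop_ge0 (G := G) (v := u0) (l := 4) (fun u hu => by rw [hd4 _ u hu]; decide)
    rw [hd4 _ _ h0.symm, w4] at dr
    have hB : Bd G 4 := ((c.pk h0).p0 (n5 u0)
      (Or.inl ⟨u1, dg_iso_adj' h0 (hd4 _ _ h0)⟩)).del (by omega)
    exact ⟨hB.mono (by omega), fun _ => hB, fun ⟨v, hv⟩ => absurd hv (h3 v),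
      fun hf => absurd hf.three.choose_spec (h3 _), fun _ h => by
        rcases h with ⟨v, hv⟩ | h
        · exact absurd hv (h3 v)
        · exact absurd hx (h x)⟩

theorem n_no3 (c : Ctx G) {v : V} (dv : dg G v = 5) (h3 : ∀ v, dg G v ≠ 3) : Pack G := by
  have fin : Bd G 6 → ((∃ x, dg G x = 4) → Bd G 4) → Pack G := fun h6 h4 =>
    ⟨h6, fun ⟨u, hu⟩ => h4 ⟨u, by have := h3 u; omega⟩, fun ⟨u, hu⟩ => absurd hu (h3 u),
      fun hf => absurd hf.three.choose_spec (h3 _), fun h5 => absurd dv (h5 v)⟩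
  by_cases h4 : ∃ x, dg G x = 4
  · obtain ⟨x, hx⟩ := h4
    obtain ⟨a, b, hab, da, db⟩ := cross c.cn (fun u => dg G u = 5) dv (by omega)
      (v := x) (by omega) (by omega)
    have db : dg G b = 4 := by
      have := c.gd.nb hab
      have := h3 b
      omega
    have dr := drop_ge1 hab c.gd.l3
    rw [da, db] at dr
    simp only [w5, dl4] at dr
    have hB : Bd G 4 := ((c.pk hab).p3 ⟨b, dg_iso_adj' hab db⟩).del (by omega)
    exact fin (hB.mono (by omega)) (fun _ => hB)
  · refine fin ?_ (fun h => absurd h h4)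
    push Not at h4
    obtain ⟨u, hu⟩ := dg_pos.1 (show 0 < dg G v by omega)
    have du : dg G u = 5 := by
      have := c.gd.nb hu
      have := h3 u
      have := h4 u
      omega
    have dr := drop_ge0 (G := G) (v := v) c.gd.l3
    rw [dv, w5] at dr
    exact ((c.pk hu).p4 ⟨u, Or.inr (dg_iso_adj' hu du)⟩).del (by omega)

end


section
variable {V : Type*} [Fintype V] {G : SimpleGraph V}

/-- standing assumptions in the last case -/
structure Cty (G : SimpleGraph V) (x q : V) : Prop extends Ctx G where
  nf : ¬ F1 G
  one4 : ∀ v a b, dg G v = 5 → G.Adj v a → G.Adj v b → dg G a = 4 → dg G b = 4 → a = b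
  dx : dg G x = 4
  dq : dg G q = 3
  xq : G.Adj x q
  only : ∀ u, G.Adj x u → u ≠ q → dg G u = 4 ∨ dg G u = 5

variable {x q : V}

theorem Cty.n53 (c : Cty G x q) {v u : V} (h : G.Adj v u) (hv : dg G v = 5) : dg G u ≠ 3 :=
  fun hu => c.nf ⟨v, u, h, hv, hu⟩

/-- neighbours of a degree five neighbour of `x` -/
theorem Cty.five (c : Cty G x q) {g u : V} (hg : dg G g = 5) (hx : G.Adj x g) (hu : G.Adj g u)
    (hux : u ≠ x) : dg G u = 5 := by
  rcases c.gd.nb hu with h | h | h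
  · exact absurd h (c.n53 hu hg)
  · exact absurd (c.one4 g u x hg hu hx.symm h c.dx) hux
  · exact h

theorem Cty.gd_iso (c : Cty G x q) {b : V} (hb : dg G b = 5) : Gd (iso G b) := by
  intro u
  by_cases hub : u = b
  · exact Or.inl (hub ▸ dg_iso_self)
  by_cases h : G.Adj b u
  · have := dg_iso_adj h
    have := c.n53 h hb
    have := c.gd.nb h
    omega
  · rw [dg_iso_nadj hub h]
    exact c.gd u

theorem Cty.nq (c : Cty G x q) {b : V} (hb : dg G b = 5) : ¬ G.Adj b q :=
  fun h => c.n53 h hb c.dq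

theorem Cty.dq_iso (c : Cty G x q) {b : V} (hb : dg G b = 5) : dg (iso G b) q = 3 := by
  rw [dg_iso_nadj (by rintro rfl; have := c.dq; omega) (c.nq hb)]
  exact c.dq

/-- after deleting a vertex of degree five -/
theorem Cty.red (c : Cty G x q) {b : V} (hb : dg G b = 5)
    (h : Ctx (iso G b) → Bd (iso G b) 1) : Bd (iso G b) 1 := by
  have hlt := E_iso_lt (show 0 < dg G b by omega)
  have ih' : IH (E (iso G b)) V := c.ih.mono (by omega)
  by_cases hns : Ns (iso G b)
  · exact h ⟨c.ns.cn b, c.m5.iso b, c.gd_iso hb, hns, ih'⟩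
  · exact (sepL (c.ns.cn b) (c.m5.iso b) (c.gd_iso hb) ih' hns).b1 ⟨q, c.dq_iso hb⟩

theorem Cty.red2 (c : Cty G x q) {b : V} (hb : dg G b = 5)
    (h : Ctx (iso G b) → Bd (iso G b) 2) : Bd (iso G b) 2 := by
  have hlt := E_iso_lt (show 0 < dg G b by omega)
  have ih' : IH (E (iso G b)) V := c.ih.mono (by omega)
  by_cases hns : Ns (iso G b)
  · exact h ⟨c.ns.cn b, c.m5.iso b, c.gd_iso hb, hns, ih'⟩
  · exact (sepL (c.ns.cn b) (c.m5.iso b) (c.gd_iso hb) ih' hns).b2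

/-- deleting a degree five neighbour of `x` -/
theorem Cty.delg (c : Cty G x q) {g : V} (hg : dg G g = 5) (hx : G.Adj x g)
    (h : Bd (iso G g) 2) : Bd G 3 := by
  have dr := drop_ge1 hx.symm c.gd.l3
  rw [hg, c.dx] at dr
  simp only [w5, dl4] at dr
  exact h.del (by omega)

theorem Cty.nonadj (c : Cty G x q) {g g' : V} (hg : dg G g = 5) (hx : G.Adj x g)
    (hg' : dg G g' = 5) (hx' : G.Adj x g') (hne : g ≠ g') (hn : ¬ G.Adj g g') : Bd G 3 := by
  refine c.delg hg hx (Bd.mono ((c.pk hx.symm).p1 (Or.inl ⟨g', x, ?_, ?_, ?_⟩)) (by omega))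
  · exact ⟨hx'.symm, hne.symm, hx.ne⟩
  · rw [dg_iso_nadj hne.symm hn, hg']
  · exact dg_iso_adj' hx.symm c.dx

theorem Cty.type1 (c : Cty G x q) {b : V} (hb : dg G b = 5) (hbx : ¬ G.Adj x b)
    (hF : ∀ u, G.Adj x u → dg G u = 5 → G.Adj b u) (hf : Feat (iso (iso G b) x)) : Bd G 3 := by
  have xb : x ≠ b := by rintro rfl; have := c.dx; omega
  have hbx' : ¬ G.Adj b x := fun h => hbx h.symm
  have dr := drop_ge0 (G := G) (v := b) c.gd.l3
  rw [hb, w5] at dr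
  refine (c.red hb (fun c' => ?_)).del (c := 3) (by omega)
  have qb : q ≠ b := by rintro rfl; have := c.dq; omega
  have hxq : (iso G b).Adj x q := ⟨c.xq, xb, qb⟩
  have dr := drop_ge1 (l := 4) hxq (fun u hu => by
    obtain ⟨hu, _, hub⟩ := hu
    by_cases huq : u = q
    · rw [huq, c.dq_iso hb]; decide
    · by_cases hbu : G.Adj b u
      · have e := dg_iso_adj hbu
        rcases c.only u hu huq with h | h
        · rw [show dg (iso G b) u = 3 by omega]; decide
        · rw [show dg (iso G b) u = 4 by omega]; decide
      · rw [dg_iso_nadj hub hbu]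
        rcases c.only u hu huq with h | h
        · rw [h]; decide
        · exact absurd (hF u hu h) hbu)
  rw [dg_iso_nadj xb hbx', c.dx, c.dq_iso hb] at dr
  simp only [w4, dl3] at dr
  exact ((c'.pk hxq).p1 hf).del (by omega)

/-- the degree in the twice reduced graph -/
theorem dg2_11 {b x u : V} {n : ℕ} (h1 : G.Adj b u) (h2 : G.Adj x u) (hbx : x ≠ b)
    (hn : dg G u = n + 2) : dg (iso (iso G b) x) u = n := by
  have e1 := dg_iso_adj h1
  have e2 := dg_iso_adj (G := iso G b) (v := x) (u := u) ⟨h2, hbx, h1.ne'⟩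
  omega

theorem dg2_10 {b x u : V} {n : ℕ} (h1 : G.Adj b u) (h2 : ¬ G.Adj x u) (hux : u ≠ x)
    (hn : dg G u = n + 1) : dg (iso (iso G b) x) u = n := by
  have e1 := dg_iso_adj h1
  rw [dg_iso_nadj (G := iso G b) hux (fun h => h2 h.1)]
  omega

theorem dg2_00 {b x u : V} (h1 : ¬ G.Adj b u) (h2 : ¬ G.Adj x u) (hux : u ≠ x) (hub : u ≠ b) :
    dg (iso (iso G b) x) u = dg G u := by
  rw [dg_iso_nadj (G := iso G b) hux (fun h => h2 h.1), dg_iso_nadj hub h1]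

theorem Cty.f1 (c : Cty G x q) {g : V} (hg : dg G g = 5) (hx : G.Adj x g)
    (hF : ∀ u, G.Adj x u → dg G u = 5 → u = g) : Bd G 3 := by
  have d5 : ∀ u, G.Adj g u → u ≠ x → dg G u = 5 := fun u hu hux => c.five hg hx hu hux
  have nx : ∀ u, G.Adj g u → u ≠ x → ¬ G.Adj x u := fun u hu hux h =>
    hu.ne' (hF u h (d5 u hu hux))
  have main : ∀ b, G.Adj g b → b ≠ x → Feat (iso (iso G b) x) → Bd G 3 := by
    intro b hb hbx hf
    exact c.type1 (d5 b hb hbx) (nx b hb hbx) (fun u h1 h2 => hF u h1 h2 ▸ hb.symm) hf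
  by_cases hn : ∃ b y, G.Adj g b ∧ b ≠ x ∧ G.Adj g y ∧ y ≠ x ∧ y ≠ b ∧ ¬ G.Adj b y
  · obtain ⟨b, y, hb, hbx, hy, hyx, hyb, hby⟩ := hn
    refine main b hb hbx (Or.inl ⟨y, g, ⟨⟨hy.symm, hyb, hb.ne⟩, hyx, hx.ne'⟩, ?_, ?_⟩)
    · rw [dg2_00 hby (nx y hy hyx) hyx hyb]
      exact d5 y hy hyx
    · exact dg2_11 hb.symm hx hbx.symm hg
  · push Not at hn
    have h4 : ((nb G g).erase x).card = 4 := by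
      rw [Finset.card_erase_of_mem (mem_nb.2 hx.symm)]
      rw [dg] at hg
      omega
    obtain ⟨b, hb⟩ := Finset.card_pos.1 (show 0 < ((nb G g).erase x).card by omega)
    have h3 : (((nb G g).erase x).erase b).card = 3 := by
      rw [Finset.card_erase_of_mem hb]; omega
    obtain ⟨a, y, d, hay, had, hyd, hs⟩ := Finset.card_eq_three.1 h3
    simp only [Finset.mem_erase, mem_nb] at hb
    have mem : ∀ u, u ∈ (((nb G g).erase x).erase b) → u ≠ b ∧ u ≠ x ∧ G.Adj g u := by
      intro u hu
      simpa using hu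
    have ha := mem a (by rw [hs]; simp)
    have hy := mem y (by rw [hs]; simp)
    have hd := mem d (by rw [hs]; simp)
    have adj : ∀ u v, G.Adj g u → G.Adj g v → u ≠ x → v ≠ x → u ≠ b → v ≠ b → G.Adj u v →
        (iso (iso G b) x).Adj u v := fun u v _ _ h1 h2 h3 h4 h => ⟨⟨h, h3, h4⟩, h1, h2⟩
    have deg : ∀ u, u ≠ b ∧ u ≠ x ∧ G.Adj g u → dg (iso (iso G b) x) u = 4 := fun u hu =>
      dg2_10 (hn b u hb.2 hb.1 hu.2.2 hu.2.1 hu.1) (nx u hu.2.2 hu.2.1) hu.2.1 (d5 u hu.2.2 hu.2.1)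
    refine main b hb.2 hb.1 (Or.inr (Or.inr (Or.inl ⟨g, a, y, d, ?_, ?_, ?_, ?_, ?_, ?_, ?_,
      deg a ha, deg y hy, deg d hd⟩)))
    · exact ⟨⟨ha.2.2, hb.2.ne, ha.1⟩, hx.ne', ha.2.1⟩
    · exact ⟨⟨hy.2.2, hb.2.ne, hy.1⟩, hx.ne', hy.2.1⟩
    · exact ⟨⟨hd.2.2, hb.2.ne, hd.1⟩, hx.ne', hd.2.1⟩
    · exact adj _ _ ha.2.2 hy.2.2 ha.2.1 hy.2.1 ha.1 hy.1
        (hn a y ha.2.2 ha.2.1 hy.2.2 hy.2.1 (Ne.symm hay))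
    · exact adj _ _ ha.2.2 hd.2.2 ha.2.1 hd.2.1 ha.1 hd.1
        (hn a d ha.2.2 ha.2.1 hd.2.2 hd.2.1 (Ne.symm had))
    · exact adj _ _ hy.2.2 hd.2.2 hy.2.1 hd.2.1 hy.1 hd.1
        (hn y d hy.2.2 hy.2.1 hd.2.2 hd.2.1 (Ne.symm hyd))
    · exact dg2_11 hb.2.symm hx hb.1.symm hg

end


section
variable {V : Type*} [Fintype V] {G : SimpleGraph V} {x q : V}

theorem Cty.xne (c : Cty G x q) {u : V} (h : dg G u = 5) : u ≠ x := by
  rintro rfl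
  have := c.dx
  omega

theorem Cty.f2a (c : Cty G x q) {g g' : V} (hg : dg G g = 5) (hx : G.Adj x g)
    (hF : ∀ u, G.Adj x u → dg G u = 5 → u = g ∨ u = g')
    {b y : V} (hb : G.Adj g b) (hb' : G.Adj g' b) (hbx : b ≠ x)
    (hy : G.Adj g y) (hyx : y ≠ x) (hyg : y ≠ g') (hyb : y ≠ b) (hby : ¬ G.Adj b y) : Bd G 3 := by
  have db := c.five hg hx hb hbx
  have dy := c.five hg hx hy hyx
  have nxy : ¬ G.Adj x y := fun h => by
    rcases hF y h dy with e | e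
    · exact hy.ne' e
    · exact hyg e
  refine c.type1 db (fun h => ?_) (fun u h1 h2 => ?_) (Or.inl ⟨y, g, ?_, ?_, ?_⟩)
  · rcases hF b h db with e | e
    · exact hb.ne' e
    · exact hb'.ne' e
  · rcases hF u h1 h2 with rfl | rfl
    · exact hb.symm
    · exact hb'.symm
  · exact ⟨⟨hy.symm, hyb, hb.ne⟩, hyx, hx.ne'⟩
  · rw [dg2_00 hby nxy hyx hyb, dy]
  · exact dg2_11 hb.symm hx hbx.symm hg

theorem Cty.f2 (c : Cty G x q) {g g' : V} (hg : dg G g = 5) (hx : G.Adj x g)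
    (hg' : dg G g' = 5) (hx' : G.Adj x g') (hgg : G.Adj g g')
    (hF : ∀ u, G.Adj x u → dg G u = 5 → u = g ∨ u = g') : Bd G 3 := by
  have hF' : ∀ u, G.Adj x u → dg G u = 5 → u = g' ∨ u = g := fun u h1 h2 => (hF u h1 h2).symm
  set T := ((nb G g).erase x).erase g' with hT
  set T' := ((nb G g').erase x).erase g with hT'
  have mT : ∀ u, u ∈ T ↔ u ≠ g' ∧ u ≠ x ∧ G.Adj g u := fun u => by simp [hT]
  have mT' : ∀ u, u ∈ T' ↔ u ≠ g ∧ u ≠ x ∧ G.Adj g' u := fun u => by simp [hT']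
  have cT : T.card = 3 := by
    rw [hT, Finset.card_erase_of_mem (by simp [hgg, hx'.ne']),
      Finset.card_erase_of_mem (by simp [hx.symm])]
    rw [dg] at hg
    omega
  have cT' : T'.card = 3 := by
    rw [hT', Finset.card_erase_of_mem (by simp [hgg.symm, hx.ne']),
      Finset.card_erase_of_mem (by simp [hx'.symm])]
    rw [dg] at hg'
    omega
  have dT : ∀ u ∈ T, dg G u = 5 := fun u hu => by
    have := (mT u).1 hu
    exact c.five hg hx this.2.2 this.2.1
  have nx : ∀ u ∈ T, ¬ G.Adj x u := fun u hu h => by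
    have h' := (mT u).1 hu
    rcases hF u h (dT u hu) with e | e
    · exact h'.2.2.ne' e
    · exact h'.1 e
  by_cases hA : ∃ b y, b ∈ T ∧ b ∈ T' ∧ (y ∈ T ∨ y ∈ T') ∧ y ≠ b ∧ ¬ G.Adj b y
  · obtain ⟨b, y, hb, hb', hy, hyb, hby⟩ := hA
    have hb := (mT b).1 hb
    have hb' := (mT' b).1 hb'
    rcases hy with hy | hy
    · have hy := (mT y).1 hy
      exact c.f2a hg hx hF hb.2.2 hb'.2.2 hb.2.1 hy.2.2 hy.2.1 hy.1 hyb hby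
    · have hy := (mT' y).1 hy
      exact c.f2a hg' hx' hF' hb'.2.2 hb.2.2 hb.2.1 hy.2.2 hy.2.1 hy.1 hyb hby
  push Not at hA
  by_cases hB : ∃ b, b ∈ T ∧ b ∈ T'
  · obtain ⟨b, hb, hb'⟩ := hB
    have eb := (mT b).1 hb
    have eb' := (mT' b).1 hb'
    have hsub : insert g (insert g' ((T ∪ T').erase b)) ⊆ nb G b := by
      intro u hu
      rw [mem_nb]
      simp only [Finset.mem_insert, Finset.mem_erase, Finset.mem_union] at hu
      rcases hu with rfl | rfl | ⟨h1, h2⟩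
      · exact eb.2.2.symm
      · exact eb'.2.2.symm
      · exact hA b u hb hb' h2 h1
    have hle := Finset.card_le_card hsub
    have n1 : g' ∉ (T ∪ T').erase b := by
      simp [mT, mT']
    have n2 : g ∉ insert g' ((T ∪ T').erase b) := by
      simp [mT, mT', hgg.ne]
    rw [Finset.card_insert_of_notMem n2, Finset.card_insert_of_notMem n1,
      Finset.card_erase_of_mem (Finset.mem_union_left _ hb)] at hle
    have db := dT b hb
    have hui := Finset.card_union_add_card_inter T T'
    have h2 : 1 < (T ∩ T').card := by
      rw [dg] at db
      omega
    obtain ⟨y, hy, hyb⟩ := Finset.exists_mem_ne h2 b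
    have hyT := Finset.mem_of_mem_inter_left hy
    have hyT' := Finset.mem_of_mem_inter_right hy
    have ey := (mT y).1 hyT
    have ey' := (mT' y).1 hyT'
    have h3 : 0 < ((T.erase b).erase y).card := by
      rw [Finset.card_erase_of_mem (by simp [hyb, hyT]), Finset.card_erase_of_mem hb]
      omega
    obtain ⟨d, hd⟩ := Finset.card_pos.1 h3
    simp only [Finset.mem_erase] at hd
    obtain ⟨hdy, hdb, hdT⟩ := hd
    have ed := (mT d).1 hdT
    have aby := hA b y hb hb' (Or.inl hyT) hyb
    have abd := hA b d hb hb' (Or.inl hdT) hdb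
    have ayd := hA y d hyT hyT' (Or.inl hdT) hdy
    refine c.type1 db (nx b hb) (fun u h1 h2 => ?_) (Or.inr (Or.inl ⟨y, g, g', d, hgg.ne,
      ed.2.2.ne, ed.1.symm, ?_, ?_, ?_, ?_, ?_, ?_, Or.inr ?_⟩))
    · rcases hF u h1 h2 with rfl | rfl
      · exact eb.2.2.symm
      · exact eb'.2.2.symm
    · exact ⟨⟨ey.2.2.symm, hyb, eb.2.2.ne⟩, ey.2.1, hx.ne'⟩
    · exact ⟨⟨ey'.2.2.symm, hyb, eb'.2.2.ne⟩, ey.2.1, hx'.ne'⟩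
    · exact ⟨⟨ayd, hyb, hdb⟩, ey.2.1, ed.2.1⟩
    · exact dg2_10 aby (nx y hyT) ey.2.1 (dT y hyT)
    · exact dg2_11 eb.2.2.symm hx eb.2.1.symm hg
    · exact dg2_11 eb'.2.2.symm hx' eb.2.1.symm hg'
    · exact dg2_10 abd (nx d hdT) ed.2.1 (dT d hdT)
  push Not at hB
  have hnT : ∀ u ∈ T, ¬ G.Adj g' u := fun u hu h => by
    have e := (mT u).1 hu
    exact hB u hu ((mT' u).2 ⟨e.2.2.ne', e.2.1, h⟩)
  refine c.delg hg' hx' (c.red2 hg' (fun c' => ?_))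
  obtain ⟨b, y, d, hby, hbd, hyd, hs⟩ := Finset.card_eq_three.1 cT
  have key : ∀ b ∈ T, Feat (iso (iso G g') b) → Bd (iso G g') 2 := by
    intro b hb hf
    have e := (mT b).1 hb
    have abg : (iso G g').Adj b g := ⟨e.2.2.symm, e.1, hgg.ne⟩
    have dr := drop_ge1 abg c'.gd.l3
    rw [dg_iso_nadj e.1 (hnT b hb), dT b hb, dg_iso_adj' hgg.symm hg] at dr
    simp only [w5, dl4] at dr
    exact ((c'.pk abg).p1 hf).del (by omega)
  have dgg : ∀ b ∈ T, dg (iso (iso G g') b) g = 3 := fun b hb => by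
    have e := (mT b).1 hb
    exact dg2_11 hgg.symm e.2.2.symm e.1 hg
  by_cases hn : ∃ b y, b ∈ T ∧ y ∈ T ∧ y ≠ b ∧ ¬ G.Adj b y
  · obtain ⟨b, y, hb, hy, hyb, hby⟩ := hn
    have e := (mT b).1 hb
    have f := (mT y).1 hy
    refine key b hb (Or.inl ⟨y, g, ⟨⟨f.2.2.symm, f.1, hgg.ne⟩, hyb, e.2.2.ne⟩, ?_, dgg b hb⟩)
    rw [dg2_00 (hnT y hy) hby hyb f.1, dT y hy]
  · push Not at hn
    have hb : b ∈ T := by rw [hs]; simp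
    have hy : y ∈ T := by rw [hs]; simp
    have hd : d ∈ T := by rw [hs]; simp
    have eb := (mT b).1 hb
    have ey := (mT y).1 hy
    have ed := (mT d).1 hd
    have qg' : q ≠ g' := by rintro rfl; have := c.dq; omega
    have qb : q ≠ b := by rintro rfl; have := c.dq; have := dT _ hb; omega
    have qg : q ≠ g := by rintro rfl; have := c.dq; omega
    have deg : ∀ u ∈ T, u ≠ b → dg (iso (iso G g') b) u = 4 := fun u hu hub => by
      have e := (mT u).1 hu
      have : (iso G g').Adj b u := ⟨hn b u hb hu hub, eb.1, e.1⟩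
      exact dg_iso_adj' this (by rw [dg_iso_nadj e.1 (hnT u hu), dT u hu])
    refine key b hb (Or.inr (Or.inr (Or.inr ⟨x, g, q, y, d, qg, ?_, ?_, ?_, ?_, ?_, ?_, dgg b hb,
      ?_, deg y hy hby.symm, deg d hd hbd.symm⟩)))
    · exact ⟨⟨hx, hx'.ne, hgg.ne⟩, eb.2.1.symm, eb.2.2.ne⟩
    · exact ⟨⟨c.xq, hx'.ne, qg'⟩, eb.2.1.symm, qb⟩
    · exact ⟨⟨ey.2.2, hgg.ne, ey.1⟩, eb.2.2.ne, hby.symm⟩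
    · exact ⟨⟨ed.2.2, hgg.ne, ed.1⟩, eb.2.2.ne, hbd.symm⟩
    · exact ⟨⟨hn y d hy hd hyd.symm, ey.1, ed.1⟩, hby.symm, hbd.symm⟩
    · exact dg2_10 hx'.symm (fun h => nx b hb h.symm) eb.2.1.symm c.dx
    · rw [dg2_00 (c.nq hg') (c.nq (dT b hb)) qb qg', c.dq]

theorem Cty.f3a (c : Cty G x q) {g g' g'' e : V} (hg : dg G g = 5) (hx : G.Adj x g)
    (hg' : dg G g' = 5) (hx' : G.Adj x g') (hg'' : dg G g'' = 5) (hx'' : G.Adj x g'')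
    (h1 : G.Adj g g') (h2 : G.Adj g g'') (h3 : G.Adj g' g'')
    (hF : ∀ u, G.Adj x u → dg G u = 5 → u = g ∨ u = g' ∨ u = g'')
    (he : G.Adj g' e) (hex : e ≠ x) (heg : e ≠ g) (heg'' : e ≠ g'') (hne : ¬ G.Adj g e) :
    Bd G 3 := by
  have de := c.five hg' hx' he hex
  have qg : q ≠ g := by rintro rfl; have := c.dq; omega
  have qg' : q ≠ g' := by rintro rfl; have := c.dq; omega
  have qg'' : q ≠ g'' := by rintro rfl; have := c.dq; omega
  have qe : q ≠ e := by rintro rfl; have := c.dq; omega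
  have nxe : ¬ G.Adj x e := fun h => by
    rcases hF e h de with h | h | h
    · exact heg h
    · exact he.ne' h
    · exact heg'' h
  refine c.delg hg hx (c.red2 hg (fun c' => ?_))
  have qx : (iso G g).Adj q x := ⟨c.xq.symm, qg, hx.ne⟩
  have dHx : dg (iso G g) x = 3 := dg_iso_adj' hx.symm c.dx
  have dHq := c.dq_iso hg
  have dHg' : dg (iso G g) g' = 4 := dg_iso_adj' h1 hg'
  have dHg'' : dg (iso G g) g'' = 4 := dg_iso_adj' h2 hg''
  have dHe : dg (iso G g) e = 5 := by rw [dg_iso_nadj heg hne, de]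
  have nq' : ¬ (iso G g).Adj q g' := fun h => c.nq hg' h.1.symm
  have nq'' : ¬ (iso G g).Adj q g'' := fun h => c.nq hg'' h.1.symm
  have nqe : ¬ (iso G g).Adj q e := fun h => c.nq de h.1.symm
  have dr := drop_ge1 (l := 4) qx (fun u hu => by
    have e1 := c'.gd.nb hu
    have e2 : dg G u ≠ 5 := fun h => c.nq h hu.1.symm
    have e3 := c.m5 u
    have e4 := dg_iso_le (G := G) (v := g) (u := u)
    rcases e1 with h | h | h
    · rw [h]; decide
    · rw [h]; decide
    · omega)
  rw [dHx, dHq] at dr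
  simp only [w3, dl3] at dr
  obtain ⟨hP, hB⟩ := c'.del_simp (a := g') (b := g'') qx (dg_iso_adj' qx dHx)
    ⟨⟨hx', hx.ne, h1.ne'⟩, c.xq.ne, qg'.symm⟩ ⟨⟨hx'', hx.ne, h2.ne'⟩, c.xq.ne, qg''.symm⟩
    ⟨⟨h3, h1.ne', h2.ne'⟩, qg'.symm, qg''.symm⟩
  have dJg' : dg (iso (iso G g) q) g' = 4 := by rw [dg_iso_nadj qg'.symm nq', dHg']
  have dJg'' : dg (iso (iso G g) q) g'' = 4 := by rw [dg_iso_nadj qg''.symm nq'', dHg'']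
  refine hB _ _ (hP.p1 (Or.inl ⟨e, g', ?_, ?_, ?_⟩)) ?_
  · exact ⟨⟨⟨he.symm, heg, h1.ne'⟩, qe.symm, qg'.symm⟩, hex, hx'.ne'⟩
  · rw [dg_iso_nadj (G := iso (iso G g) q) hex (fun h => nxe h.1.1), dg_iso_nadj qe.symm nqe, dHe]
  · exact dg_iso_adj' (G := iso (iso G g) q) ⟨⟨hx', hx.ne, h1.ne'⟩, c.xq.ne, qg'.symm⟩ dJg'
  · rw [dJg', dJg'']
    simp only [dl4]
    omega

theorem Cty.f3 (c : Cty G x q) {g g' g'' : V} (hg : dg G g = 5) (hx : G.Adj x g)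
    (hg' : dg G g' = 5) (hx' : G.Adj x g') (hg'' : dg G g'' = 5) (hx'' : G.Adj x g'')
    (h1 : G.Adj g g') (h2 : G.Adj g g'') (h3 : G.Adj g' g'')
    (hF : ∀ u, G.Adj x u → dg G u = 5 → u = g ∨ u = g' ∨ u = g'') : Bd G 3 := by
  by_cases ha : ∀ e, e ≠ x → e ≠ g → e ≠ g' → e ≠ g'' → G.Adj g e → G.Adj g' e ∧ G.Adj g'' e
  swap
  · push Not at ha
    obtain ⟨e, n0, n1, n2, n3, ae, ae'⟩ := ha
    by_cases h' : G.Adj g' e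
    · exact c.f3a (g := g'') (g' := g) (g'' := g') hg'' hx'' hg hx hg' hx' h2.symm h3.symm h1
        (fun u a b => by have := hF u a b; tauto) ae n0 n3 n2 (ae' h')
    · exact c.f3a (g := g') (g' := g) (g'' := g'') hg' hx' hg hx hg'' hx'' h1.symm h3 h2
        (fun u a b => by have := hF u a b; tauto) ae n0 n2 n3 h'
  set O := (((nb G g).erase x).erase g').erase g'' with hO
  have cO : O.card = 2 := by
    rw [hO, Finset.card_erase_of_mem (by simp [h2, hx''.ne', h3.ne']),
      Finset.card_erase_of_mem (by simp [h1, hx'.ne']),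
      Finset.card_erase_of_mem (by simp [hx.symm])]
    rw [dg] at hg
    omega
  obtain ⟨b, d, hbd, hs⟩ := Finset.card_eq_two.1 cO
  have mem : ∀ u ∈ O, u ≠ g'' ∧ u ≠ g' ∧ u ≠ x ∧ G.Adj g u := fun u hu => by simpa [hO] using hu
  have hb := mem b (by rw [hs]; simp)
  have hd := mem d (by rw [hs]; simp)
  have hb' := ha b hb.2.2.1 hb.2.2.2.ne' hb.2.1 hb.1 hb.2.2.2
  have hd' := ha d hd.2.2.1 hd.2.2.2.ne' hd.2.1 hd.1 hd.2.2.2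
  have db := c.five hg hx hb.2.2.2 hb.2.2.1
  have dd := c.five hg hx hd.2.2.2 hd.2.2.1
  have nxb : ¬ G.Adj x b := fun h => by
    rcases hF b h db with h | h | h
    · exact hb.2.2.2.ne' h
    · exact hb.2.1 h
    · exact hb.1 h
  have nxd : ¬ G.Adj x d := fun h => by
    rcases hF d h dd with h | h | h
    · exact hd.2.2.2.ne' h
    · exact hd.2.1 h
    · exact hd.1 h
  refine c.type1 db nxb (fun u a1 a2 => ?_) ?_
  · rcases hF u a1 a2 with rfl | rfl | rfl
    · exact hb.2.2.2.symm
    · exact hb'.1.symm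
    · exact hb'.2.symm
  have k1 : dg (iso (iso G b) x) g = 3 := dg2_11 hb.2.2.2.symm hx hb.2.2.1.symm hg
  have k2 : dg (iso (iso G b) x) g' = 3 := dg2_11 hb'.1.symm hx' hb.2.2.1.symm hg'
  have k3 : dg (iso (iso G b) x) g'' = 3 := dg2_11 hb'.2.symm hx'' hb.2.2.1.symm hg''
  by_cases hadj : G.Adj b d
  · refine Or.inr (Or.inl ⟨d, g, g', g'', h1.ne, h2.ne, h3.ne, ?_, ?_, ?_, ?_, k1, k2, Or.inl k3⟩)
    · exact ⟨⟨hd.2.2.2.symm, hbd.symm, hb.2.2.2.ne⟩, hd.2.2.1, hx.ne'⟩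
    · exact ⟨⟨hd'.1.symm, hbd.symm, hb'.1.ne⟩, hd.2.2.1, hx'.ne'⟩
    · exact ⟨⟨hd'.2.symm, hbd.symm, hb'.2.ne⟩, hd.2.2.1, hx''.ne'⟩
    · exact dg2_10 hadj nxd hd.2.2.1 dd
  · refine Or.inl ⟨d, g, ⟨⟨hd.2.2.2.symm, hbd.symm, hb.2.2.2.ne⟩, hd.2.2.1, hx.ne'⟩, ?_, k1⟩
    rw [dg2_00 hadj nxd hd.2.2.1 hbd.symm, dd]

theorem Cty.fin (c : Cty G x q) {g : V} (hg : dg G g = 5) (hx : G.Adj x g) : Bd G 3 := by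
  by_cases hna : ∃ g g', dg G g = 5 ∧ G.Adj x g ∧ dg G g' = 5 ∧ G.Adj x g' ∧ g ≠ g' ∧ ¬ G.Adj g g'
  · obtain ⟨g, g', a1, a2, a3, a4, a5, a6⟩ := hna
    exact c.nonadj a1 a2 a3 a4 a5 a6
  push Not at hna
  by_cases h1 : ∀ u, G.Adj x u → dg G u = 5 → u = g
  · exact c.f1 hg hx h1
  push Not at h1
  obtain ⟨g', hx', hg', hne⟩ := h1
  by_cases h2 : ∀ u, G.Adj x u → dg G u = 5 → u = g ∨ u = g'
  · exact c.f2 hg hx hg' hx' (hna _ _ hg hx hg' hx' hne.symm) h2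
  push Not at h2
  obtain ⟨g'', hx'', hg'', n1, n2⟩ := h2
  refine c.f3 hg hx hg' hx' hg'' hx'' (hna _ _ hg hx hg' hx' hne.symm)
    (hna _ _ hg hx hg'' hx'' n1.symm) (hna _ _ hg' hx' hg'' hx'' n2.symm) (fun u a1 a2 => ?_)
  have qg : q ≠ g := by rintro rfl; have := c.dq; omega
  have qg' : q ≠ g' := by rintro rfl; have := c.dq; omega
  have qg'' : q ≠ g'' := by rintro rfl; have := c.dq; omega
  have := nb_of_card (G := G) (v := x) {q, g, g', g''} (by
    simp [c.xq, hx, hx', hx'']) (by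
    rw [c.dx, Finset.card_insert_of_notMem (by simp [qg, qg', qg'']),
      Finset.card_insert_of_notMem (by simp [hne.symm, n1.symm]), Finset.card_pair n2.symm]) u a1
  simp only [Finset.mem_insert, Finset.mem_singleton] at this
  rcases this with h | h
  · subst h
    have := c.dq
    omega
  · exact h

theorem n_53 (c : Ctx G) {v u : V} (dv : dg G v = 5) (du : dg G u = 3) : Bd G 3 := by
  by_cases hf : F1 G
  · exact (featL c (Or.inl hf)).mono (by omega)
  by_cases h2 : ∃ v a b, dg G v = 5 ∧ G.Adj v a ∧ G.Adj v b ∧ dg G a = 4 ∧ dg G b = 4 ∧ a ≠ b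
  · obtain ⟨v, a, b, d1, ha, hb, da, db, hab⟩ := h2
    have dr := drop_ge2 ha hb hab c.gd.l3
    rw [d1, da, db] at dr
    simp only [w5, dl4] at dr
    exact ((c.pk ha).p3 ⟨a, dg_iso_adj' ha da⟩).del (by omega)
  push Not at h2
  obtain ⟨q, x, hqx, dq, dx⟩ := cross c.cn (fun u => dg G u = 3) du (by omega)
    (v := v) (by omega) (by omega)
  have hxq := hqx.symm
  have dx : dg G x = 4 := by
    rcases c.gd.nb hqx with h | h | h
    · exact absurd h dx
    · exact h
    · exact absurd ⟨x, q, hxq, h, dq⟩ hf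
  by_cases h5 : ∃ g, G.Adj x g ∧ dg G g = 5
  · obtain ⟨g, hg, dg5⟩ := h5
    by_cases hr : ∃ q', G.Adj x q' ∧ q' ≠ q ∧ dg G q' = 3
    · obtain ⟨q', a1, a2, a3⟩ := hr
      have dr := drop_ge2 hxq a1 a2.symm c.gd.l3
      rw [dx, dq, a3] at dr
      simp only [w4, dl3] at dr
      exact ((c.pk hg).p4 ⟨g, Or.inr (dg_iso_adj' hg dg5)⟩).del (by omega)
    · push Not at hr
      have cc : Cty G x q := ⟨c, hf, h2, dx, dq, hxq, fun u hu huq => by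
        have := c.gd.nb hu
        have := hr u hu huq
        omega⟩
      exact cc.fin dg5 hg
  · push Not at h5
    by_cases h4 : ∃ y, G.Adj x y ∧ dg G y = 4
    · obtain ⟨y, hy, dy⟩ := h4
      have dr := drop_ge1 (l := 4) hxq (fun u hu => by
        have := h5 u hu
        rcases c.gd.nb hu with h | h | h
        · rw [h]; decide
        · rw [h]; decide
        · omega)
      rw [dx, dq] at dr
      simp only [w4, dl3] at dr
      exact ((c.pk hy).p3 ⟨y, dg_iso_adj' hy dy⟩).del (by omega)
    · push Not at h4
      have dr := drop_ge0 (G := G) (v := x) (l := 8) (fun u hu => by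
        have := h5 u hu
        have := h4 u hu
        rcases c.gd.nb hu with h | h | h
        · rw [h]; decide
        · omega
        · omega)
      rw [dx, w4] at dr
      exact (c.pk hxq).p6.del (by omega)

theorem nstep (c : Ctx G) : Pack G := by
  by_cases h0 : ∀ a b, ¬ G.Adj a b
  · exact Pack.of0 ⟨0, tr_bot h0, by omega⟩
  push Not at h0
  obtain ⟨a, b, hab⟩ := h0
  by_cases h5 : ∀ v, dg G v ≠ 5
  · exact n_no5 c h5 hab
  push Not at h5
  obtain ⟨v, hv⟩ := h5
  by_cases h3 : ∀ v, dg G v ≠ 3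
  · exact n_no3 c hv h3
  push Not at h3
  obtain ⟨u, hu⟩ := h3
  have hB := n_53 c hv hu
  exact ⟨hB.mono (by omega), fun _ => hB.mono (by omega), fun _ => hB, featL c,
    fun h => absurd hv (h v)⟩

theorem packAll (n : ℕ) : ∀ G : SimpleGraph V, E G = n → Cn G → M5 G → Pack G := by
  induction n using Nat.strong_induction_on with
  | _ n hind =>
    intro G hG hcn h5
    have ih : IH (E G) V := fun H hH => hind _ (by omega) H rfl
    by_cases hR : ∃ z, dg G z = 1 ∨ dg G z = 2
    · obtain ⟨z, hz⟩ := hR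
      exact stepR hcn h5 ih hz
    push Not at hR
    have hgd : Gd G := fun u => by
      have := hR u
      have := h5 u
      omega
    by_cases hns : Ns G
    · exact nstep ⟨hcn, h5, hgd, hns, ih⟩
    · have s := sepL hcn h5 hgd ih hns
      exact ⟨s.b2.mono (by omega), fun _ => s.b2.mono (by omega), fun _ => s.b2.mono (by omega),
        fun hf => s.b1 hf.three, fun h _ => s.b0 h⟩

end

end K4T

theorem statement1 {V : Type*} [Fintype V] (G : SimpleGraph V) (hconn : G.Connected) :
    (transNum G : ℝ) ≤ (3 / 16) * ((G.edgeSet.ncard : ℝ) + 1) :=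
  K4T.final (fun G h1 h2 => (K4T.packAll _ G rfl h1 h2).p6) G hconn
end

section
/- Let G be a critical finite simple graph. Then for every edge uv ∈ E(G), there exists a set S ⊆ V(G) \ {u, v} such that S ∪ {u} and S ∪ {v} are both minimum transversals of G (i.e., both are transversals of size s(G)). -/
open SimpleGraph

theorem HasK4Minor.map_hom {V W : Type*} {G : SimpleGraph V} {H : SimpleGraph W}
    (f : G →g H) (hf : Function.Injective f) (h : HasK4Minor G) : HasK4Minor H := by
  obtain ⟨B, h1, h2, h3, h4⟩ := h
  refine ⟨fun i => Set.image f (B i), fun i => (h1 i).image f, fun i => ?_, fun i j hij => ?_,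
    fun i j hij => ?_⟩
  · let g : G.induce (B i) →g H.induce (Set.image f (B i)) :=
      { toFun := fun x => ⟨f x.1, Set.mem_image_of_mem f x.2⟩
        map_rel' := fun {a b} hab => f.map_rel hab }
    refine (h2 i).map g ?_
    rintro ⟨_, x, hx, rfl⟩
    exact ⟨⟨x, hx⟩, rfl⟩
  · exact (Set.disjoint_image_iff hf).2 (h3 i j hij)
  · obtain ⟨a, ha, b, hb, hab⟩ := h4 i j hij
    exact ⟨f a, Set.mem_image_of_mem f ha, f b, Set.mem_image_of_mem f hb, f.map_rel hab⟩

theorem IsTransversal.mono_of {V : Type*} {G H : SimpleGraph V} {X Y : Finset V}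
    (hYX : Y ⊆ X) (hadj : ∀ a b, a ∉ X → b ∉ X → G.Adj a b → H.Adj a b)
    (hY : IsTransversal H Y) : IsTransversal G X := by
  intro h
  let g : G.induce ((↑X : Set V)ᶜ) →g H.induce ((↑Y : Set V)ᶜ) :=
    { toFun := fun x => ⟨x.1, fun hx => x.2 (hYX hx)⟩
      map_rel' := fun {a b} hab => hadj a.1 b.1 a.2 b.2 hab }
  refine hY (h.map_hom g fun a b hab => ?_)
  exact Subtype.ext (congrArg (fun z => z.1) hab)

theorem transNum_le {V : Type*} {G : SimpleGraph V} {X : Finset V}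
    (h : IsTransversal G X) : transNum G ≤ X.card := Nat.sInf_le ⟨X, rfl, h⟩

theorem exists_min_transversal {V : Type*} [Fintype V] (G : SimpleGraph V) :
    ∃ X : Finset V, X.card = transNum G ∧ IsTransversal G X := by
  refine Nat.sInf_mem (s := {n : ℕ | ∃ X : Finset V, X.card = n ∧ IsTransversal G X})
    ⟨_, Finset.univ, rfl, ?_⟩
  rintro ⟨B, h1, -⟩
  obtain ⟨x, -⟩ := h1 0
  exact x.2 (by simp)

theorem statement9 {V : Type*} [Fintype V] [DecidableEq V] (G : SimpleGraph V)
    (hcrit : ∀ e ∈ G.edgeSet, transNum (G.deleteEdges {e}) < transNum G)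
    (u v : V) (huv : G.Adj u v) :
    ∃ S : Finset V, u ∉ S ∧ v ∉ S ∧
      IsTransversal G (insert u S) ∧ (insert u S).card = transNum G ∧
      IsTransversal G (insert v S) ∧ (insert v S).card = transNum G := by
  obtain ⟨S, hS, hT⟩ := exists_min_transversal (G.deleteEdges {s(u, v)})
  have hlt := hcrit s(u, v) huv
  rw [← hS] at hlt
  have key : ∀ X : Finset V, S ⊆ X → (u ∈ X ∨ v ∈ X) → IsTransversal G X := by
    intro X hX huvX
    refine hT.mono_of hX fun a b ha hb hab => ?_
    rw [SimpleGraph.deleteEdges_adj]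
    refine ⟨hab, fun he => ?_⟩
    rw [Set.mem_singleton_iff, Sym2.eq_iff] at he
    rcases he with ⟨rfl, rfl⟩ | ⟨rfl, rfl⟩ <;> tauto
  have hu : u ∉ S := fun h => absurd (transNum_le (key S subset_rfl (Or.inl h))) (by omega)
  have hv : v ∉ S := fun h => absurd (transNum_le (key S subset_rfl (Or.inr h))) (by omega)
  have ku := key (insert u S) (Finset.subset_insert _ _) (Or.inl (Finset.mem_insert_self _ _))
  have kv := key (insert v S) (Finset.subset_insert _ _) (Or.inr (Finset.mem_insert_self _ _))
  have lu := transNum_le ku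
  have lv := transNum_le kv
  rw [Finset.card_insert_of_notMem hu] at lu
  rw [Finset.card_insert_of_notMem hv] at lv
  refine ⟨S, hu, hv, ku, ?_, kv, ?_⟩
  · rw [Finset.card_insert_of_notMem hu]; omega
  · rw [Finset.card_insert_of_notMem hv]; omega
end
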